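/- arXiv:1110.5007 — 3 statements merged into one kernel-verified Lean document; each statement's English description precedes it below -/
import Mathlib

section
/- Let n ≥ 1 and let k be an integer with k ≥ 3, k > n/2 and k ≤ n−1. Let H be the complete k-uniform hypergraph on the vertex set {1,...,n}. Then the coloring complex Λ(H) is a pure simplicial complex of dimension n−k−1 and Λ(H) is shellable. -/
/-- The set of faces of the coloring complex `Λ(H)` of a hypergraph `H` (a set of
hyperedges, each a finset of vertices) on the vertex set `Fin n`.  A face is a chain
`S_1 ⊊ ⋯ ⊊ S_t` of nonempty proper subsets of the vertex set (corresponding to the ordered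
set partition with blocks `S_1, S_2 \ S_1, …, V \ S_t`) such that at least one of these
blocks contains a hyperedge; the block below `S ∈ F ∪ {V}` is `S` minus the union of the
members of `F` strictly contained in `S`. -/
def lamFaces (n : ℕ) (H : Finset (Finset (Fin n))) : Set (Finset (Finset (Fin n))) :=
  {F | (∀ S ∈ F, S.Nonempty ∧ S ≠ Finset.univ) ∧
    (∀ S ∈ F, ∀ T ∈ F, S ⊆ T ∨ T ⊆ S) ∧
    (∃ e ∈ H, ∃ S ∈ insert Finset.univ F, e ⊆ S \ (F.filter (· ⊂ S)).sup id)}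

/-- `F` is a facet (maximal face) of the complex `K`. -/
def IsFacetIn {α : Type} (K : Set (Finset α)) (F : Finset α) : Prop :=
  F ∈ K ∧ ∀ G ∈ K, F ⊆ G → F = G

/-- A complex `K` (given as its set of faces, each face being the finset of its vertices;
an `r`-dimensional face has `r+1` elements) is shellable: its facets can be enumerated
`F_0, …, F_{N-1}` (without repetition) so that for each `l ≥ 1` the complex
`(⋃_{i<l} \bar F_i) ∩ \bar F_l` is nonempty and pure of dimension `dim F_l - 1`, i.e.
each of its maximal elements `G` satisfies `|G| = |F_l| - 1`. -/
def Shellable {α : Type} (K : Set (Finset α)) : Prop :=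
  ∃ (N : ℕ) (F : Fin N → Finset α),
    Function.Injective F ∧ (∀ i, IsFacetIn K (F i)) ∧ (∀ G, IsFacetIn K G → ∃ i, F i = G) ∧
    ∀ l : Fin N, 0 < (l : ℕ) →
      (∃ G : Finset α, G ⊆ F l ∧ ∃ i : Fin N, (i : ℕ) < (l : ℕ) ∧ G ⊆ F i) ∧
      (∀ G : Finset α, (G ⊆ F l ∧ ∃ i : Fin N, (i : ℕ) < (l : ℕ) ∧ G ⊆ F i) →
        (∀ G' : Finset α, (G' ⊆ F l ∧ ∃ i : Fin N, (i : ℕ) < (l : ℕ) ∧ G' ⊆ F i) →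
          G ⊆ G' → G = G') →
        G.card + 1 = (F l).card)

section

open Finset

/-- Shelling criterion by a key: if the facets have the same size and, whenever `F ≠ G` are facets
with `key F ≤ key G`, some `x ∈ G \ F` can be exchanged to reach a facet of smaller key, then every
enumeration of the facets by increasing key is a shelling. -/
theorem shellable_of_key {α κ : Type} [DecidableEq α] [LinearOrder κ] {K : Set (Finset α)}
    (hfin : {F | IsFacetIn K F}.Finite) (key : Finset α → κ)
    (hkey : ∀ F G, IsFacetIn K F → IsFacetIn K G → F ≠ G → key F ≤ key G →
      ∃ x ∈ G, x ∉ F ∧ ∃ F', IsFacetIn K F' ∧ key F' < key G ∧ G.erase x ⊆ F') :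
    Shellable K := by
  classical
  let l : List (Finset α) := hfin.toFinset.toList
  let m := l.mergeSort (fun F G => decide (key F ≤ key G))
  have hperm : m.Perm l := List.mergeSort_perm _ _
  have hnd : m.Nodup := hperm.nodup_iff.2 (Finset.nodup_toList _)
  have hmem : ∀ F, F ∈ m ↔ IsFacetIn K F := fun F => by
    rw [hperm.mem_iff]
    simp [l]
  have hsort : m.Pairwise (fun F G => key F ≤ key G) := by
    have := List.pairwise_mergeSort (le := fun F G => decide (key F ≤ key G))
      (fun a b c hab hbc => by simp only [decide_eq_true_eq] at *; exact hab.trans hbc)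
      (fun a b => by simpa using le_total (key a) (key b)) l
    simpa using this
  have hmono : ∀ i j : Fin m.length, i < j → key (m.get i) ≤ key (m.get j) :=
    List.pairwise_iff_get.1 hsort
  refine ⟨m.length, m.get, List.nodup_iff_injective_get.1 hnd,
    fun i => (hmem _).1 (m.get_mem i), fun G hG => List.mem_iff_get.1 ((hmem G).2 hG), ?_⟩
  intro t ht
  refine ⟨⟨∅, empty_subset _, ⟨0, ht.trans t.2⟩, ht, empty_subset _⟩, ?_⟩
  rintro G ⟨hGt, i, hit, hGi⟩ hmax
  have hne : m.get i ≠ m.get t := fun h => by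
    have := List.nodup_iff_injective_get.1 hnd h
    rw [this] at hit
    exact lt_irrefl _ hit
  obtain ⟨x, hxt, hxi, F', hF', hlt, hsub⟩ := hkey _ _ ((hmem _).1 (m.get_mem i))
    ((hmem _).1 (m.get_mem t)) hne (hmono i t hit)
  obtain ⟨j, rfl⟩ := List.mem_iff_get.1 ((hmem F').2 hF')
  have hjt : j < t := by
    by_contra hcon
    rcases (not_lt.1 hcon).eq_or_lt with rfl | h
    · exact lt_irrefl _ hlt
    · exact absurd (hmono t j h) (not_le.2 hlt)
  have hG : G = (m.get t).erase x :=
    hmax _ ⟨erase_subset _ _, j, hjt, hsub⟩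
      (subset_erase.2 ⟨hGt, fun h => hxi (hGi h)⟩)
  rw [hG, card_erase_add_one hxt]

/-- For every chain of finsets and every `r` there is a set of size `r` comparable to all members
of the chain. -/
theorem exists_card_eq_comparable {n : ℕ} {F : Finset (Finset (Fin n))}
    (hF : ∀ S ∈ F, ∀ T ∈ F, S ⊆ T ∨ T ⊆ S) {r : ℕ} (hr : r ≤ n) :
    ∃ M : Finset (Fin n), M.card = r ∧ ∀ T ∈ F, T ⊆ M ∨ M ⊆ T := by
  classical
  obtain ⟨L, hL, hLmax⟩ : ∃ L : Finset (Fin n), (L = ∅ ∨ L ∈ F) ∧ L.card ≤ r ∧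
      ∀ T ∈ F, T.card ≤ r → T ⊆ L := by
    by_cases h : (F.filter (·.card ≤ r)).Nonempty
    · obtain ⟨L, hL, hmax⟩ := exists_max_image _ card h
      rw [mem_filter] at hL
      refine ⟨L, .inr hL.1, hL.2, fun T hT hTr => ?_⟩
      rcases hF T hT L hL.1 with h | h
      · exact h
      · exact (eq_of_subset_of_card_le h (hmax T (mem_filter.2 ⟨hT, hTr⟩))).ge
    · refine ⟨∅, .inl rfl, by simp, fun T hT hTr => (h ⟨T, mem_filter.2 ⟨hT, hTr⟩⟩).elim⟩
  obtain ⟨U, hU, hUmin⟩ : ∃ U : Finset (Fin n), (U = univ ∨ U ∈ F) ∧ r ≤ U.card ∧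
      ∀ T ∈ F, r ≤ T.card → U ⊆ T := by
    by_cases h : (F.filter (r ≤ ·.card)).Nonempty
    · obtain ⟨U, hU, hmin⟩ := exists_min_image _ card h
      rw [mem_filter] at hU
      refine ⟨U, .inr hU.1, hU.2, fun T hT hTr => ?_⟩
      rcases hF T hT U hU.1 with h | h
      · exact (eq_of_subset_of_card_le h (hmin T (mem_filter.2 ⟨hT, hTr⟩))).ge
      · exact h
    · refine ⟨univ, .inl rfl, by simpa using hr,
        fun T hT hTr => (h ⟨T, mem_filter.2 ⟨hT, hTr⟩⟩).elim⟩
  have hLU : L ⊆ U := by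
    rcases hL with rfl | hL
    · exact empty_subset _
    rcases hU with rfl | hU
    · exact subset_univ _
    rcases hF L hL U hU with h | h
    · exact h
    · exact (eq_of_subset_of_card_le h (hLmax.1.trans hUmin.1)).ge
  obtain ⟨M, hLM, hMU, hM⟩ := exists_subsuperset_card_eq hLU hLmax.1 hUmin.1
  refine ⟨M, hM, fun T hT => ?_⟩
  rcases le_total T.card r with h | h
  · exact .inl ((hLmax.2 T hT h).trans hLM)
  · exact .inr (hMU.trans (hUmin.2 T hT h))

/-- `A ⊆ B` differ by `k` elements and no member of `F` cuts `B \ A`. -/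
def IsGap {n : ℕ} (k : ℕ) (F : Finset (Finset (Fin n))) (A B : Finset (Fin n)) : Prop :=
  A ⊆ B ∧ B.card = A.card + k ∧ ∀ T ∈ F, T ⊆ A ∨ B ⊆ T

theorem mem_lamFaces_powersetCard_iff {n k : ℕ} {F : Finset (Finset (Fin n))} :
    F ∈ lamFaces n (powersetCard k univ) ↔
      (∀ S ∈ F, S.Nonempty ∧ S ≠ univ) ∧ (∀ S ∈ F, ∀ T ∈ F, S ⊆ T ∨ T ⊆ S) ∧
        ∃ A B, IsGap k F A B := by
  classical
  refine and_congr_right fun _ => and_congr_right fun hchain => ⟨?_, ?_⟩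
  · rintro ⟨e, he, S, hS, heS⟩
    rw [mem_powersetCard_univ] at he
    have hd : Disjoint ((F.filter (· ⊂ S)).sup id) e :=
      disjoint_left.2 fun a ha hae => (mem_sdiff.1 (heS hae)).2 ha
    refine ⟨(F.filter (· ⊂ S)).sup id, (F.filter (· ⊂ S)).sup id ∪ e, subset_union_left,
      by rw [card_union_of_disjoint hd, he], fun T hT => ?_⟩
    by_cases h : T ⊂ S
    · exact .inl (le_sup (f := id) (mem_filter.2 ⟨hT, h⟩))
    · have hST : S ⊆ T := by
        rcases mem_insert.1 hS with rfl | hS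
        · by_contra hne
          exact h ⟨subset_univ _, hne⟩
        · rcases hchain S hS T hT with h' | h'
          · exact h'
          · by_contra hne
            exact h ⟨h', hne⟩
      refine .inr ((union_subset ?_ (heS.trans sdiff_subset)).trans hST)
      exact Finset.sup_le fun R hR => (mem_filter.1 hR).2.subset
  · rintro ⟨A, B, hAB, hcard, hgap⟩
    obtain ⟨S, hS, hmin⟩ := exists_min_image ((insert univ F).filter (B ⊆ ·)) card
      ⟨univ, by simp⟩
    rw [mem_filter] at hS
    refine ⟨B \ A, ?_, S, hS.1, ?_⟩
    · rw [mem_powersetCard_univ, card_sdiff_of_subset hAB]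
      omega
    · refine sdiff_subset_sdiff hS.2 (Finset.sup_le fun T hT => ?_)
      rw [mem_filter] at hT
      refine (hgap T hT.1).resolve_right fun hBT => ?_
      exact absurd (hmin T (mem_filter.2 ⟨mem_insert_of_mem hT.1, hBT⟩))
        (not_le.2 (card_lt_card hT.2))

theorem card_injOn_of_chain {n : ℕ} {F : Finset (Finset (Fin n))}
    (hF : ∀ S ∈ F, ∀ T ∈ F, S ⊆ T ∨ T ⊆ S) : Set.InjOn card (F : Set (Finset (Fin n))) := by
  intro S hS T hT h
  rcases hF S hS T hT with h' | h'
  · exact eq_of_subset_of_card_le h' h.ge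
  · exact (eq_of_subset_of_card_le h' h.le).symm

theorem card_Icc_union_Ico {n k a : ℕ} (hk : 1 ≤ k) (ha : a + k ≤ n) :
    (Icc 1 a ∪ Ico (a + k) n).card = n - k := by
  rw [card_union_of_disjoint, Nat.card_Icc, Nat.card_Ico]
  · omega
  · refine disjoint_left.2 fun r hr hr' => ?_
    rw [mem_Icc] at hr
    rw [mem_Ico] at hr'
    omega

theorem IsGap.card_add_le {n k : ℕ} {F : Finset (Finset (Fin n))} {A B : Finset (Fin n)}
    (h : IsGap k F A B) : A.card + k ≤ n := by
  simpa [← h.2.1] using card_le_univ B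

theorem image_card_subset_of_isGap {n k : ℕ} {F : Finset (Finset (Fin n))}
    (hF : ∀ S ∈ F, S.Nonempty ∧ S ≠ univ) {A B : Finset (Fin n)} (hgap : IsGap k F A B) :
    F.image card ⊆ Icc 1 A.card ∪ Ico (A.card + k) n := by
  intro r hr
  obtain ⟨T, hT, rfl⟩ := mem_image.1 hr
  rw [mem_union, mem_Icc, mem_Ico]
  have h0 := (hF T hT).1.card_pos
  have h1 : T.card < n := by
    simpa using (card_lt_iff_ne_univ T).2 (hF T hT).2
  rcases hgap.2.2 T hT with h | h
  · exact .inl ⟨h0, card_le_card h⟩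
  · exact .inr ⟨hgap.2.1 ▸ card_le_card h, h1⟩

theorem card_le_of_mem_lamFaces {n k : ℕ} (hk : 1 ≤ k) {F : Finset (Finset (Fin n))}
    (hF : F ∈ lamFaces n (powersetCard k univ)) : F.card ≤ n - k := by
  obtain ⟨hne, hchain, A, B, hgap⟩ := mem_lamFaces_powersetCard_iff.1 hF
  rw [← card_image_of_injOn (card_injOn_of_chain hchain),
    ← card_Icc_union_Ico hk hgap.card_add_le]
  exact card_le_card (image_card_subset_of_isGap hne hgap)

theorem IsFacetIn.image_card {n k : ℕ} (hk : 1 ≤ k) {F : Finset (Finset (Fin n))}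
    (hF : IsFacetIn (lamFaces n (powersetCard k univ)) F) {A B : Finset (Fin n)}
    (hgap : IsGap k F A B) : F.image card = Icc 1 A.card ∪ Ico (A.card + k) n := by
  obtain ⟨hne, hchain, -⟩ := mem_lamFaces_powersetCard_iff.1 hF.1
  refine (image_card_subset_of_isGap hne hgap).antisymm fun r hr => ?_
  rw [mem_union, mem_Icc, mem_Ico] at hr
  have hn := hgap.card_add_le
  have hB := hgap.2.1
  have hchain' : ∀ S ∈ insert A (insert B F), ∀ T ∈ insert A (insert B F), S ⊆ T ∨ T ⊆ S := by
    have hA : ∀ T ∈ F, T ⊆ A ∨ A ⊆ T := fun T hT =>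
      (hgap.2.2 T hT).imp_right hgap.1.trans
    have hB : ∀ T ∈ F, T ⊆ B ∨ B ⊆ T := fun T hT =>
      (hgap.2.2 T hT).imp_left fun h => h.trans hgap.1
    intro S hS T hT
    rw [mem_insert, mem_insert] at hS hT
    rcases hS with rfl | rfl | hS <;> rcases hT with rfl | rfl | hT
    · exact .inl subset_rfl
    · exact .inl hgap.1
    · exact (hA T hT).symm
    · exact .inr hgap.1
    · exact .inl subset_rfl
    · exact (hB T hT).symm
    · exact hA S hS
    · exact hB S hS
    · exact hchain S hS T hT
  obtain ⟨M, hM, hcomp⟩ := exists_card_eq_comparable hchain' (r := r) (by omega)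
  refine mem_image.2 ⟨M, ?_, hM⟩
  have hface : insert M F ∈ lamFaces n (powersetCard k univ) := by
    refine mem_lamFaces_powersetCard_iff.2 ⟨?_, ?_, A, B, hgap.1, hgap.2.1, ?_⟩
    · rw [forall_mem_insert]
      refine ⟨⟨card_pos.1 (by omega), ?_⟩, hne⟩
      rintro rfl
      rw [card_univ, Fintype.card_fin] at hM
      omega
    · intro S hS T hT
      rw [mem_insert] at hS hT
      rcases hS with rfl | hS <;> rcases hT with rfl | hT
      · exact .inl subset_rfl
      · exact (hcomp T (by simp [hT])).symm
      · exact hcomp S (by simp [hS])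
      · exact hchain S hS T hT
    · rw [forall_mem_insert]
      refine ⟨?_, hgap.2.2⟩
      rcases hr with hr | hr
      · left
        rcases hcomp A (by simp) with h | h
        · exact (eq_of_subset_of_card_le h (by omega)).ge
        · exact h
      · right
        rcases hcomp B (by simp) with h | h
        · exact h
        · exact (eq_of_subset_of_card_le h (by omega)).ge
  rw [hF.2 _ hface (subset_insert _ _)]
  exact mem_insert_self _ _

theorem isFacetIn_iff_card {n k : ℕ} (hk : 1 ≤ k) {F : Finset (Finset (Fin n))} :
    IsFacetIn (lamFaces n (powersetCard k univ)) F ↔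
      F ∈ lamFaces n (powersetCard k univ) ∧ F.card = n - k := by
  refine ⟨fun hF => ⟨hF.1, ?_⟩, fun ⟨hF, hcard⟩ => ⟨hF, fun G hG hFG =>
    eq_of_subset_of_card_le hFG (hcard ▸ card_le_of_mem_lamFaces hk hG)⟩⟩
  obtain ⟨-, hchain, A, B, hgap⟩ := mem_lamFaces_powersetCard_iff.1 hF.1
  rw [← card_image_of_injOn (card_injOn_of_chain hchain), hF.image_card hk hgap,
    card_Icc_union_Ico hk hgap.card_add_le]

theorem exists_isFacetIn {n k : ℕ} (hkn : k ≤ n) :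
    ∃ F, IsFacetIn (lamFaces n (powersetCard k univ)) F := by
  have hempty : ∅ ∈ lamFaces n (powersetCard k univ) := by
    obtain ⟨B, hB⟩ := exists_subset_card_eq (s := (univ : Finset (Fin n))) (n := k) (by simpa)
    exact mem_lamFaces_powersetCard_iff.2
      ⟨by simp, by simp, ∅, B, empty_subset _, by simp [hB.2], by simp⟩
  obtain ⟨F, -, hF⟩ := (Set.toFinite (lamFaces n (powersetCard k univ))).exists_le_maximal hempty
  exact ⟨F, hF.1, fun G hG hFG => hFG.antisymm (hF.2 hG hFG)⟩

theorem IsFacetIn.card_filter_card_lt {n k : ℕ} (hk : 1 ≤ k) (hhalf : n < 2 * k)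
    {F : Finset (Finset (Fin n))} (hF : IsFacetIn (lamFaces n (powersetCard k univ)) F)
    {A B : Finset (Fin n)} (hgap : IsGap k F A B) :
    (F.filter (·.card < k)).card = A.card := by
  obtain ⟨-, hchain, -⟩ := mem_lamFaces_powersetCard_iff.1 hF.1
  have hinj : Set.InjOn card (F.filter (·.card < k) : Set (Finset (Fin n))) :=
    (card_injOn_of_chain hchain).mono (coe_subset.2 (filter_subset _ _))
  have hn := hgap.card_add_le
  rw [← card_image_of_injOn hinj]
  have : (F.filter (·.card < k)).image card = (F.image card).filter (· < k) := by
    rw [filter_image]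
  rw [this, hF.image_card hk hgap, show (Icc 1 A.card ∪ Ico (A.card + k) n).filter (· < k) =
    Icc 1 A.card by ext r; simp only [mem_filter, mem_union, mem_Icc, mem_Ico]; omega]
  simp

/-- Lowering the position of the large block: the largest small member of a facet can be exchanged
for a large set. -/
theorem IsFacetIn.exists_shift {n k : ℕ} (hk : 2 ≤ k) (hhalf : n < 2 * k)
    {F : Finset (Finset (Fin n))} (hF : IsFacetIn (lamFaces n (powersetCard k univ)) F)
    {A B : Finset (Fin n)} (hgap : IsGap k F A B) (hA : 1 ≤ A.card) :
    A ∈ F ∧ ∃ F', IsFacetIn (lamFaces n (powersetCard k univ)) F' ∧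
      (F'.filter (·.card < k)).card < (F.filter (·.card < k)).card ∧ F.erase A ⊆ F' := by
  obtain ⟨hne, hchain, -⟩ := mem_lamFaces_powersetCard_iff.1 hF.1
  have hrank := hF.image_card (by omega) hgap
  have hn := hgap.card_add_le
  have hB := hgap.2.1
  have hAF : A ∈ F := by
    have : A.card ∈ F.image card := by
      rw [hrank, mem_union, mem_Icc]
      exact .inl ⟨hA, le_rfl⟩
    obtain ⟨T, hT, hTA⟩ := mem_image.1 this
    rcases hgap.2.2 T hT with h | h
    · rwa [← eq_of_subset_of_card_le h hTA.ge]
    · have := card_le_card h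
      omega
  refine ⟨hAF, ?_⟩
  obtain ⟨M, hM, hcomp⟩ := exists_card_eq_comparable hchain (r := A.card - 1) (by omega)
  have hsub : ∀ T ∈ F, T.card < A.card → T ⊆ M := fun T hT hTA => by
    rcases hcomp T hT with h | h
    · exact h
    · exact (eq_of_subset_of_card_le h (by omega)).ge
  have hMA : M ⊆ A := by
    rcases hcomp A hAF with h | h
    · have := card_le_card h
      omega
    · exact h
  obtain ⟨U, hMU, hUB, hU⟩ := exists_subsuperset_card_eq (hMA.trans hgap.1)
    (n := A.card - 1 + k) (by omega) (by omega)
  have hUF : U ∉ F := fun h => by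
    have := mem_image_of_mem card h
    rw [hrank] at this
    simp only [mem_union, mem_Icc, mem_Ico] at this
    omega
  have hgap' : ∀ T ∈ F.erase A, T ⊆ M ∨ B ⊆ T := fun T hT => by
    rw [mem_erase] at hT
    refine (hgap.2.2 T hT.2).imp_left fun h => hsub T hT.2 ?_
    exact card_lt_card (h.ssubset_of_ne hT.1)
  refine ⟨insert U (F.erase A), (isFacetIn_iff_card (by omega)).2 ⟨?_, ?_⟩, ?_,
    subset_insert _ _⟩
  · refine mem_lamFaces_powersetCard_iff.2 ⟨?_, ?_, M, U, hMU, by omega, ?_⟩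
    · rw [forall_mem_insert]
      refine ⟨⟨card_pos.1 (by omega), ?_⟩, fun T hT => hne T (mem_of_mem_erase hT)⟩
      rintro rfl
      rw [card_univ, Fintype.card_fin] at hU
      omega
    · have hcomp' : ∀ T ∈ F.erase A, T ⊆ U ∨ U ⊆ T := fun T hT =>
        (hgap' T hT).imp (fun h => h.trans hMU) hUB.trans
      intro S hS T hT
      rw [mem_insert] at hS hT
      rcases hS with rfl | hS <;> rcases hT with rfl | hT
      · exact .inl subset_rfl
      · exact (hcomp' T hT).symm
      · exact hcomp' S hS
      · exact hchain S (mem_of_mem_erase hS) T (mem_of_mem_erase hT)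
    · rw [forall_mem_insert]
      exact ⟨.inr subset_rfl, fun T hT => (hgap' T hT).imp_right hUB.trans⟩
  · rw [card_insert_of_notMem fun h => hUF (mem_of_mem_erase h), card_erase_add_one hAF]
    exact ((isFacetIn_iff_card (by omega)).1 hF).2
  · rw [filter_insert, if_neg (by omega)]
    refine card_lt_card ⟨filter_subset_filter _ (erase_subset _ _), fun h => ?_⟩
    have := h (mem_filter.2 ⟨hAF, by omega⟩)
    simp at this

/-- The pairs `i < j` such that some member of the chain `F` contains `j` but not `i`, i.e. the
inversions of the ordered set partition given by `F`. -/
def chainInversions {n : ℕ} (F : Finset (Finset (Fin n))) : Finset (Fin n × Fin n) :=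
  univ.filter fun p => p.1 < p.2 ∧ ∃ S ∈ F, p.2 ∈ S ∧ p.1 ∉ S

theorem mem_chainInversions {n : ℕ} {F : Finset (Finset (Fin n))} {i j : Fin n} :
    (i, j) ∈ chainInversions F ↔ i < j ∧ ∃ S ∈ F, j ∈ S ∧ i ∉ S := by
  simp [chainInversions]

/-- The image of a family of sets under a permutation of the ground set. -/
def permFamily {n : ℕ} (σ : Equiv.Perm (Fin n)) (F : Finset (Finset (Fin n))) :
    Finset (Finset (Fin n)) :=
  F.map (mapEmbedding σ.toEmbedding).toEmbedding

theorem mem_permFamily {n : ℕ} {σ : Equiv.Perm (Fin n)} {F : Finset (Finset (Fin n))}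
    {T : Finset (Fin n)} : T ∈ permFamily σ F ↔ ∃ S ∈ F, S.map σ.toEmbedding = T := by
  simp [permFamily, mapEmbedding_apply]

theorem IsFacetIn.permFamily {n k : ℕ} (hk : 1 ≤ k) {F : Finset (Finset (Fin n))}
    (hF : IsFacetIn (lamFaces n (powersetCard k univ)) F) (σ : Equiv.Perm (Fin n)) :
    IsFacetIn (lamFaces n (powersetCard k univ)) (permFamily σ F) := by
  rw [isFacetIn_iff_card hk] at hF ⊢
  obtain ⟨hne, hchain, A, B, hAB, hcard, hgap⟩ := mem_lamFaces_powersetCard_iff.1 hF.1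
  refine ⟨mem_lamFaces_powersetCard_iff.2 ⟨fun T hT => ?_, fun S hS T hT => ?_,
    A.map σ.toEmbedding, B.map σ.toEmbedding, map_subset_map.2 hAB, by simpa, fun T hT => ?_⟩,
    by simpa [_root_.permFamily] using hF.2⟩
  · obtain ⟨R, hR, rfl⟩ := mem_permFamily.1 hT
    refine ⟨(hne R hR).1.map, fun h => (hne R hR).2 ?_⟩
    rw [← card_eq_iff_eq_univ] at h ⊢
    simpa using h
  · obtain ⟨P, hP, rfl⟩ := mem_permFamily.1 hS
    obtain ⟨R, hR, rfl⟩ := mem_permFamily.1 hT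
    simpa only [map_subset_map] using hchain P hP R hR
  · obtain ⟨R, hR, rfl⟩ := mem_permFamily.1 hT
    simpa only [map_subset_map] using hgap R hR

theorem card_filter_permFamily {n k : ℕ} (σ : Equiv.Perm (Fin n)) (F : Finset (Finset (Fin n))) :
    ((permFamily σ F).filter (·.card < k)).card = (F.filter (·.card < k)).card := by
  simp [permFamily, filter_map, mapEmbedding_apply]

theorem map_swap_eq_self {n : ℕ} {u v : Fin n} {T : Finset (Fin n)} (h : u ∈ T ↔ v ∈ T) :
    T.map (Equiv.swap u v).toEmbedding = T := by
  ext a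
  rw [mem_map_equiv, Equiv.symm_swap]
  by_cases hau : a = u
  · rw [hau, Equiv.swap_apply_left, h]
  by_cases hav : a = v
  · rw [hav, Equiv.swap_apply_right, h]
  rw [Equiv.swap_apply_of_ne_of_ne hau hav]

/-- At a descent of the chain `F` at `x`, swapping the largest element of the block ending at `x`
with the smallest element of the next block changes only `x` and removes an inversion. -/
theorem exists_swap_of_descent {n : ℕ} {F : Finset (Finset (Fin n))}
    (hchain : ∀ S ∈ F, ∀ T ∈ F, S ⊆ T ∨ T ⊆ S) {x : Finset (Fin n)} (hx : x ∈ F) {u v : Fin n}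
    (hu : u ∈ x ∧ ∀ T ∈ F, T ⊂ x → u ∉ T) (hv : v ∉ x ∧ ∀ T ∈ F, x ⊂ T → v ∈ T) (hvu : v < u) :
    ∃ σ : Equiv.Perm (Fin n), F.erase x ⊆ permFamily σ F ∧
      (chainInversions (permFamily σ F)).card < (chainInversions F).card := by
  classical
  obtain ⟨u', hu', humax⟩ := exists_max_image
    (univ.filter fun u => u ∈ x ∧ ∀ T ∈ F, T ⊂ x → u ∉ T) id ⟨u, mem_filter.2 ⟨mem_univ _, hu⟩⟩
  obtain ⟨v', hv', hvmin⟩ := exists_min_image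
    (univ.filter fun v => v ∉ x ∧ ∀ T ∈ F, x ⊂ T → v ∈ T) id ⟨v, mem_filter.2 ⟨mem_univ _, hv⟩⟩
  have hlt : v' < u' := (hvmin v (mem_filter.2 ⟨mem_univ _, hv⟩)).trans_lt
    (hvu.trans_le (humax u (mem_filter.2 ⟨mem_univ _, hu⟩)))
  simp only [mem_filter, mem_univ, true_and, id] at hu' hv' humax hvmin
  clear hu hv hvu u v
  have hside : ∀ T ∈ F, T ≠ x → T ⊂ x ∨ x ⊂ T := fun T hT hTx =>
    (hchain T hT x hx).imp (fun h => h.ssubset_of_ne hTx) fun h => h.ssubset_of_ne hTx.symm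
  have hiff : ∀ T ∈ F, T ≠ x → (u' ∈ T ↔ v' ∈ T) := fun T hT hTx => by
    rcases hside T hT hTx with h | h
    · exact iff_of_false (hu'.2 T hT h) fun hvT => hv'.1 (h.subset hvT)
    · exact iff_of_true (h.subset hu'.1) (hv'.2 T hT h)
  refine ⟨Equiv.swap u' v', fun T hT => ?_, card_lt_card ⟨?_, fun hsub => ?_⟩⟩
  · rw [mem_erase] at hT
    exact mem_permFamily.2 ⟨T, hT.2, map_swap_eq_self (hiff T hT.2 hT.1)⟩
  · rintro ⟨p, q⟩ hpq
    obtain ⟨hlt', T, hT, hq, hp⟩ := mem_chainInversions.1 hpq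
    refine mem_chainInversions.2 ⟨hlt', ?_⟩
    obtain ⟨S, hS, rfl⟩ := mem_permFamily.1 hT
    by_cases hSx : S = x
    · subst hSx
      rw [mem_map_equiv, Equiv.symm_swap] at hq hp
      by_cases hqv : q = v'
      · subst hqv
        have hpu : p ≠ u' := (hlt'.trans hlt).ne
        rw [Equiv.swap_apply_of_ne_of_ne hpu hlt'.ne] at hp
        by_contra! hcon
        exact absurd (hvmin p ⟨hp, fun T hT hST => hcon T hT (hv'.2 T hT hST)⟩) (not_le.2 hlt')
      have hqu : q ≠ u' := by
        rintro rfl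
        rw [Equiv.swap_apply_left] at hq
        exact hv'.1 hq
      rw [Equiv.swap_apply_of_ne_of_ne hqu hqv] at hq
      by_cases hpu : p = u'
      · subst hpu
        by_contra! hcon
        exact absurd (humax q ⟨hq, fun T hT hTS hqT => hu'.2 T hT hTS (hcon T hT hqT)⟩)
          (not_le.2 hlt')
      · have hpv : p ≠ v' := by
          rintro rfl
          rw [Equiv.swap_apply_right] at hp
          exact hp hu'.1
        rw [Equiv.swap_apply_of_ne_of_ne hpu hpv] at hp
        exact ⟨S, hS, hq, hp⟩
    · rw [map_swap_eq_self (hiff S hS hSx)] at hq hp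
      exact ⟨S, hS, hq, hp⟩
  · obtain ⟨-, T, hT, huT, hvT⟩ := mem_chainInversions.1
      (hsub (mem_chainInversions.2 ⟨hlt, x, hx, hu'.1, hv'.1⟩))
    obtain ⟨S, hS, rfl⟩ := mem_permFamily.1 hT
    by_cases hSx : S = x
    · rw [mem_map_equiv, Equiv.symm_swap, Equiv.swap_apply_left] at huT
      exact hv'.1 (hSx ▸ huT)
    · rw [map_swap_eq_self (hiff S hS hSx)] at huT hvT
      exact hvT ((hiff S hS hSx).1 huT)

/-- An inversion of `F` that no common member of `F` and `G` accounts for forces a descent of `F`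
at a set outside `G`. -/
theorem exists_descent {n : ℕ} {F G : Finset (Finset (Fin n))}
    (hchain : ∀ S ∈ F, ∀ T ∈ F, S ⊆ T ∨ T ⊆ S) {i j : Fin n} (hij : i < j)
    (hsep : ∃ S ∈ F, j ∈ S ∧ i ∉ S) (hG : ∀ T ∈ F, T ∈ G → j ∈ T → i ∈ T) :
    ∃ x ∈ F, x ∉ G ∧ ∃ u v, (u ∈ x ∧ ∀ T ∈ F, T ⊂ x → u ∉ T) ∧
      (v ∉ x ∧ ∀ T ∈ F, x ⊂ T → v ∈ T) ∧ v < u := by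
  classical
  obtain ⟨j', hj', hjmax⟩ := exists_max_image (univ.filter fun j => i < j ∧
    (∃ S ∈ F, j ∈ S ∧ i ∉ S) ∧ ∀ T ∈ F, T ∈ G → j ∈ T → i ∈ T) id
    ⟨j, mem_filter.2 ⟨mem_univ _, hij, hsep, hG⟩⟩
  simp only [mem_filter, mem_univ, true_and, id] at hj' hjmax
  clear hij hsep hG j
  obtain ⟨hij, ⟨S, hS, hjS, hiS⟩, hG⟩ := hj'
  obtain ⟨x, hx, hxmin⟩ := exists_min_image (F.filter (j' ∈ ·)) card
    ⟨S, mem_filter.2 ⟨hS, hjS⟩⟩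
  rw [mem_filter] at hx
  have hju : ∀ T ∈ F, T ⊂ x → j' ∉ T := fun T hT hTx hjT =>
    absurd (hxmin T (mem_filter.2 ⟨hT, hjT⟩)) (not_le.2 (card_lt_card hTx))
  have hix : i ∉ x := by
    rcases hchain x hx.1 S hS with h | h
    · exact fun hi => hiS (h hi)
    · rcases h.eq_or_ssubset with h | h
      · rwa [← h]
      · exact (hju S hS h hjS).elim
  refine ⟨x, hx.1, fun hxG => hix (hG x hx.1 hxG hx.2), j', ?_⟩
  by_cases hi : ∀ T ∈ F, x ⊂ T → i ∈ T
  · exact ⟨i, ⟨hx.2, hju⟩, ⟨hix, hi⟩, hij⟩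
  push Not at hi
  obtain ⟨T, hT, hxT, hiT⟩ := hi
  obtain ⟨Q, hQ, hQmin⟩ := exists_min_image (F.filter (x ⊂ ·)) card
    ⟨T, mem_filter.2 ⟨hT, hxT⟩⟩
  rw [mem_filter] at hQ
  have hQsub : ∀ R ∈ F, x ⊂ R → Q ⊆ R := fun R hR hxR => by
    rcases hchain Q hQ.1 R hR with h | h
    · exact h
    · exact (eq_of_subset_of_card_le h (hQmin R (mem_filter.2 ⟨hR, hxR⟩))).ge
  have hiQ : i ∉ Q := fun h => hiT (hQsub T hT hxT h)
  obtain ⟨v, hvQ, hvx⟩ := exists_of_ssubset hQ.2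
  refine ⟨v, ⟨hx.2, hju⟩, ⟨hvx, fun R hR hxR => hQsub R hR hxR hvQ⟩, ?_⟩
  by_contra hcon
  have hlt : j' < v := (not_lt.1 hcon).lt_of_ne fun h => hvx (h ▸ hx.2)
  refine absurd (hjmax v ⟨hij.trans hlt, ⟨Q, hQ.1, hvQ, hiQ⟩, fun R hR hRG hvR => ?_⟩)
    (not_le.2 hlt)
  rcases hchain R hR x hx.1 with h | h
  · exact (hvx (h hvR)).elim
  · exact hG R hR hRG (h hx.2)

/-- A chain is determined by its inversions and the sizes of its members. -/
theorem subset_of_chainInversions_eq {n : ℕ} {F G : Finset (Finset (Fin n))}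
    (hF : ∀ S ∈ F, ∀ T ∈ F, S ⊆ T ∨ T ⊆ S) (hG : ∀ S ∈ G, ∀ T ∈ G, S ⊆ T ∨ T ⊆ S)
    (hcard : F.image card = G.image card) (hinv : chainInversions F = chainInversions G) :
    F ⊆ G := by
  intro x hx
  obtain ⟨y, hy, hxy⟩ := mem_image.1 (hcard ▸ mem_image_of_mem card hx)
  by_contra hcon
  have hne : x ≠ y := fun h => hcon (h ▸ hy)
  obtain ⟨p, hpx, hpy⟩ := not_subset.1 fun h => hne (eq_of_subset_of_card_le h hxy.le)
  obtain ⟨q, hqy, hqx⟩ := not_subset.1 fun h => hne (eq_of_subset_of_card_le h hxy.ge).symm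
  rcases lt_or_gt_of_ne (show p ≠ q from fun h => hqx (h ▸ hpx)) with hlt | hlt
  · obtain ⟨-, T, hT, hqT, hpT⟩ := mem_chainInversions.1
      (hinv ▸ mem_chainInversions.2 ⟨hlt, y, hy, hqy, hpy⟩ : (p, q) ∈ chainInversions F)
    rcases hF T hT x hx with h | h
    · exact hqx (h hqT)
    · exact hpT (h hpx)
  · obtain ⟨-, T, hT, hpT, hqT⟩ := mem_chainInversions.1
      (hinv ▸ mem_chainInversions.2 ⟨hlt, x, hx, hpx, hqx⟩ : (q, p) ∈ chainInversions G)
    rcases hG T hT y hy with h | h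
    · exact hpy (h hpT)
    · exact hqT (h hqy)

theorem shellable_lamFaces_powersetCard {n k : ℕ} (hk : 2 ≤ k) (hhalf : n < 2 * k) :
    Shellable (lamFaces n (powersetCard k univ)) := by
  have hk1 : 1 ≤ k := by omega
  refine shellable_of_key (Set.toFinite _)
    (fun F => toLex ((F.filter (·.card < k)).card, (chainInversions F).card)) ?_
  intro F G hF hG hne hle
  obtain ⟨-, hchainF, A, B, hgapF⟩ := mem_lamFaces_powersetCard_iff.1 hF.1
  obtain ⟨-, hchainG, C, D, hgapG⟩ := mem_lamFaces_powersetCard_iff.1 hG.1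
  have hcF := hF.card_filter_card_lt hk1 hhalf hgapF
  have hcG := hG.card_filter_card_lt hk1 hhalf hgapG
  rw [Prod.Lex.toLex_le_toLex] at hle
  rcases hle with hlt | ⟨heq, hle⟩
  · have hAC : A.card < C.card := by simpa only [hcF, hcG] using hlt
    obtain ⟨hCG, F', hF', hlt', hsub⟩ := hG.exists_shift hk hhalf hgapG (by omega)
    refine ⟨C, hCG, fun hCF => ?_, F', hF', Prod.Lex.toLex_lt_toLex.2 (.inl hlt'), hsub⟩
    have := mem_image_of_mem card hCF
    have hn := hgapG.card_add_le
    rw [hF.image_card hk1 hgapF, mem_union, mem_Icc, mem_Ico] at this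
    omega
  · have hAC : A.card = C.card := by simpa only [hcF, hcG] using heq
    have hrank : F.image card = G.image card := by
      rw [hF.image_card hk1 hgapF, hG.image_card hk1 hgapG, hAC]
    by_cases hcov : chainInversions G ⊆ chainInversions F
    · have hinv := eq_of_subset_of_card_le hcov hle
      exact (hne ((subset_of_chainInversions_eq hchainF hchainG hrank hinv.symm).antisymm
        (subset_of_chainInversions_eq hchainG hchainF hrank.symm hinv))).elim
    · obtain ⟨⟨i, j⟩, hij, hnot⟩ := not_subset.1 hcov
      obtain ⟨hlt, hsep⟩ := mem_chainInversions.1 hij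
      obtain ⟨x, hxG, hxF, u, v, hu, hv, hvu⟩ := exists_descent (G := F) hchainG hlt hsep
        fun T _ hTF hjT => by
          by_contra hiT
          exact hnot (mem_chainInversions.2 ⟨hlt, T, hTF, hjT, hiT⟩)
      obtain ⟨σ, hsub, hlt'⟩ := exists_swap_of_descent hchainG hxG hu hv hvu
      exact ⟨x, hxG, hxF, permFamily σ G, hG.permFamily hk1 σ,
        Prod.Lex.toLex_lt_toLex.2 (.inr ⟨card_filter_permFamily σ G, hlt'⟩), hsub⟩

end

/-- Theorem (paper Thm. `ShellableThm1`): for `n ≥ 1` and `3 ≤ k ≤ n-1` with `k > n/2`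
(equivalently `n < 2k`), the coloring complex `Λ(H)` of the complete `k`-uniform hypergraph
`H` on `n` vertices is a simplicial complex (closed under subsets), is pure of dimension
`n-k-1` (it has a facet, and every facet has `n-k` vertices), and is shellable. -/
theorem coloring_complex_complete_shellable (n k : ℕ) (hn : 1 ≤ n) (hk : 3 ≤ k)
    (hhalf : n < 2 * k) (hkn : k ≤ n - 1) :
    (∀ F ∈ lamFaces n (Finset.powersetCard k Finset.univ),
      ∀ G ⊆ F, G ∈ lamFaces n (Finset.powersetCard k Finset.univ)) ∧
    (∃ F, IsFacetIn (lamFaces n (Finset.powersetCard k Finset.univ)) F) ∧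
    (∀ F, IsFacetIn (lamFaces n (Finset.powersetCard k Finset.univ)) F → F.card = n - k) ∧
    Shellable (lamFaces n (Finset.powersetCard k Finset.univ)) := by
  refine ⟨fun F hF G hGF => ?_, exists_isFacetIn (by omega),
    fun F hF => ((isFacetIn_iff_card (by omega)).1 hF).2,
    shellable_lamFaces_powersetCard (by omega) hhalf⟩
  obtain ⟨hne, hchain, A, B, hAB, hcard, hgap⟩ := mem_lamFaces_powersetCard_iff.1 hF
  exact mem_lamFaces_powersetCard_iff.2 ⟨fun S hS => hne S (hGF hS),
    fun S hS T hT => hchain S (hGF hS) T (hGF hT), A, B, hAB, hcard, fun T hT => hgap T (hGF hT)⟩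
end

section
/- Let k ≥ 3, k > n/2, k ≤ n−1, and let H be the complete k-uniform hypergraph on {1,...,n}. Then the reduced simplicial homology of Λ(H) over ℚ is nonzero only in dimension n−k−1, and dim H̃_{n−k−1}(Λ(H); ℚ) = (Σ_j |c_j|) − 1, where χ_H(λ) = Σ_j c_j λ^j is the chromatic polynomial of H, i.e. any polynomial satisfying χ_H(m) = (number of proper m-colorings of H) for every positive integer m. -/
open Function

/-- The map `Fin (m+1) → Fin m` which merges the blocks `j` and `j+1` of an
ordered set partition with `m+1` blocks (blocks are indexed from `0`). -/
def mergeMap {m : ℕ} (j : Fin m) : Fin (m + 1) → Fin m := fun x =>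
  if h : (x : ℕ) ≤ (j : ℕ) then ⟨(x : ℕ), lt_of_le_of_lt h j.isLt⟩
  else ⟨(x : ℕ) - 1, by have h1 := x.isLt; have h2 := j.isLt; omega⟩

/-- The linear map between spaces of `R`-valued functions on finite bases
given by a "matrix" `M` (rows indexed by `α`, columns by `β`). -/
def matLin {R : Type} [CommRing R] {α β : Type} [Fintype α] (M : α → β → R) :
    (α → R) →ₗ[R] (β → R) where
  toFun c := fun b => ∑ a, c a * M a b
  map_add' x y := by
    funext b
    simp [add_mul, Finset.sum_add_distrib]
  map_smul' r x := by
    funext b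
    simp [Finset.mul_sum, mul_assoc]

/-- Homology of a (piece of a) chain complex: the kernel of the outgoing map `d1`
modulo the image of the incoming map `d2`. -/
abbrev homologyOf {R A B C : Type} [CommRing R] [AddCommGroup A] [AddCommGroup B] [AddCommGroup C]
    [Module R A] [Module R B] [Module R C] (d2 : A →ₗ[R] B) (d1 : B →ₗ[R] C) :=
  LinearMap.ker d1 ⧸ (LinearMap.range d2).comap (LinearMap.ker d1).subtype

/-- Faces of the coloring complex `Λ(H)`: ordered set partitions of the vertex set
`Fin n` into `m` nonempty blocks (block `B_{i+1}` is the fiber `f⁻¹ i` of the surjection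
`f`), subject to the condition `P m f` (at least one block contains a hyperedge).
A partition into `m = r + 2` blocks is an `r`-dimensional face. -/
def LamBas (n : ℕ) (P : (m : ℕ) → (Fin n → Fin m) → Prop) (m : ℕ) :=
  {f : Fin n → Fin m // Function.Surjective f ∧ P m f}

instance (n : ℕ) (P : (m : ℕ) → (Fin n → Fin m) → Prop) (m : ℕ) : Finite (LamBas n P m) := by
  unfold LamBas; infer_instance

noncomputable instance (n : ℕ) (P : (m : ℕ) → (Fin n → Fin m) → Prop) (m : ℕ) :
    Fintype (LamBas n P m) := Fintype.ofFinite _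

instance (n : ℕ) (P : (m : ℕ) → (Fin n → Fin m) → Prop) (m : ℕ) :
    DecidableEq (LamBas n P m) := by unfold LamBas; infer_instance

/-- Matrix of the simplicial boundary map of `Λ(H)` (for the reduced, i.e. augmented, chain
complex): `δ(B_1, …, B_{r+2}) = Σ_{i=1}^{r+1} (-1)^i (B_1, …, B_i ∪ B_{i+1}, …, B_{r+2})`;
in the `0`-indexed encoding, merging blocks `j` and `j+1` carries the sign `(-1)^{j+1}`. -/
def lamMat (n : ℕ) (P : (m : ℕ) → (Fin n → Fin m) → Prop) (m : ℕ)
    (f : LamBas n P (m + 1)) (g : LamBas n P m) : ℚ :=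
  ∑ j : Fin m, (-1 : ℚ) ^ ((j : ℕ) + 1) * (if mergeMap j ∘ f.1 = g.1 then 1 else 0)

/-- The boundary map of the (reduced) chain complex of `Λ(H)` over `ℚ`. -/
noncomputable def lamBnd (n : ℕ) (P : (m : ℕ) → (Fin n → Fin m) → Prop) (m : ℕ) :
    (LamBas n P (m + 1) → ℚ) →ₗ[ℚ] (LamBas n P m → ℚ) := matLin (lamMat n P m)

/-- Hyperedge condition for the complex `Δ(H)` where `H` is the complete `k`-uniform
hypergraph on `n` vertices: at least one block (= fiber of `f`) contains a hyperedge,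
i.e. some `k`-element subset of the vertices lies inside one block. -/
def completeIn (n k : ℕ) : (m : ℕ) → (Fin n → Fin m) → Prop := fun m f =>
  ∃ e : Finset (Fin n), e.card = k ∧ ∃ i : Fin m, ∀ x ∈ e, f x = i

/-- Hyperedge condition for the complex `Δ(H)` where `H` is the `k`-uniform star
hypergraph at the vertex `1` (encoded as the element of `Fin n` with value `0`):
some block contains a `k`-element set containing the vertex `1`. -/
def starIn (n k : ℕ) : (m : ℕ) → (Fin n → Fin m) → Prop := fun m f =>
  ∃ e : Finset (Fin n), e.card = k ∧ (∀ x : Fin n, (x : ℕ) = 0 → x ∈ e) ∧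
    ∃ i : Fin m, ∀ x ∈ e, f x = i

/-- Condition for the quotient complex `Δ(H)^C` where `H` is the complete `k`-uniform
hypergraph: no block contains a hyperedge. -/
def completeFree (n k : ℕ) : (m : ℕ) → (Fin n → Fin m) → Prop := fun m f =>
  ∀ e : Finset (Fin n), e.card = k → ∀ i : Fin m, ∃ x ∈ e, f x ≠ i

/-- Condition for the quotient complex `Δ(H')^C` where `H'` is the `k`-uniform star
hypergraph at the vertex `1`: no block contains a hyperedge of `H'`. -/
def starFree (n k : ℕ) : (m : ℕ) → (Fin n → Fin m) → Prop := fun m f =>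
  ∀ e : Finset (Fin n), e.card = k → (∀ x : Fin n, (x : ℕ) = 0 → x ∈ e) →
    ∀ i : Fin m, ∃ x ∈ e, f x ≠ i

theorem ker_matLin_le_range_of_matching {A B C L : Type} [Fintype A] [Fintype B] [Finite C]
    [LinearOrder L] {M : A → B → ℚ} {N : B → C → ℚ}
    (hMN : ∀ a c, ∑ b, M a b * N b c = 0) {wB : B → L} {wC : C → L}
    {RB : B → A → Prop} {RC : C → B → Prop}
    (hB : ∀ {b a}, RB b a → M a b ≠ 0)
    (hBlt : ∀ {b a b'}, RB b a → M a b' ≠ 0 → b' ≠ b → wB b < wB b')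
    (hC : ∀ {c b}, RC c b → N b c ≠ 0)
    (hClt : ∀ {c b c'}, RC c b → N b c' ≠ 0 → c' ≠ c → wC c < wC c')
    (hCuniq : ∀ {c b b'}, RC c b → RC c b' → b = b')
    (hcover : ∀ b, (∃ a, RB b a) ∨ ∃ c, RC c b) :
    LinearMap.ker (matLin N) ≤ LinearMap.range (matLin M) := by
  classical
  let W : Submodule ℚ (B → ℚ) :=
    { carrier := {s | ∀ b, (∃ a, RB b a) → s b = 0}
      add_mem' := fun {x y} hx hy b hb => by simp [hx b hb, hy b hb]
      zero_mem' := fun b _ => rfl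
      smul_mem' := fun r x hx b hb => by simp [hx b hb] }
  have hsingle : ∀ b : B, Pi.single b (1 : ℚ) ∈ LinearMap.range (matLin M) ⊔ W := by
    have wf : WellFounded (fun x y : B => wB y < wB x) :=
      have : IsTrans B (fun x y : B => wB y < wB x) := ⟨fun _ _ _ h h' => h'.trans h⟩
      have : Std.Irrefl (fun x y : B => wB y < wB x) := ⟨fun _ => lt_irrefl _⟩
      Finite.wellFounded_of_trans_of_irrefl _
    intro b
    induction b using wf.induction with
    | _ b ih =>
      by_cases hb : ∃ a, RB b a
      · obtain ⟨a, ha⟩ := hb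
        have hrow : M a ∈ LinearMap.range (matLin M) :=
          ⟨Pi.single a 1, by funext x; simp [matLin, Pi.single_apply]⟩
        have hsum : M a = M a b • Pi.single b (1 : ℚ) +
            ∑ x ∈ Finset.univ.erase b, M a x • Pi.single x (1 : ℚ) := by
          rw [Finset.add_sum_erase _ (fun x => M a x • Pi.single x (1 : ℚ)) (Finset.mem_univ b)]
          funext y
          simp [Finset.sum_apply, Pi.single_apply]
        have hrest : ∑ x ∈ Finset.univ.erase b, M a x • Pi.single x (1 : ℚ) ∈
            LinearMap.range (matLin M) ⊔ W := by
          refine Submodule.sum_mem _ fun x hx => ?_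
          by_cases h0 : M a x = 0
          · simp [h0]
          · exact Submodule.smul_mem _ _ (ih x (hBlt ha h0 (Finset.ne_of_mem_erase hx)))
        have hmem : M a b • Pi.single b (1 : ℚ) ∈ LinearMap.range (matLin M) ⊔ W := by
          rw [← sub_eq_of_eq_add hsum]
          exact Submodule.sub_mem _ (Submodule.mem_sup_left hrow) hrest
        exact (Submodule.smul_mem_iff _ (hB ha)).1 hmem
      · refine Submodule.mem_sup_right fun x hx => ?_
        rw [Pi.single_apply, if_neg]
        rintro rfl
        exact hb hx
  intro z hz
  have hzmem : z ∈ LinearMap.range (matLin M) ⊔ W := by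
    rw [pi_eq_sum_univ' z]
    refine Submodule.sum_mem _ fun b _ => Submodule.smul_mem _ _ ?_
    exact hsingle b
  obtain ⟨r, hr, s, hs, rfl⟩ := Submodule.mem_sup.1 hzmem
  have hs_ker : ∀ c, ∑ b, s b * N b c = 0 := by
    intro c
    obtain ⟨t, rfl⟩ := hr
    have h1 : ∑ b, (matLin M t b + s b) * N b c = 0 := congrFun (LinearMap.mem_ker.1 hz) c
    have h2 : ∑ b, matLin M t b * N b c = 0 := by
      have : ∀ b, matLin M t b = ∑ a, t a * M a b := fun b => rfl
      simp_rw [this, Finset.sum_mul, mul_assoc]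
      rw [Finset.sum_comm]
      simp_rw [← Finset.mul_sum, hMN, mul_zero, Finset.sum_const_zero]
    simpa [add_mul, Finset.sum_add_distrib, h2] using h1
  have hs0 : s = 0 := by
    by_contra hne
    have hex : {c | ∃ b, RC c b ∧ s b ≠ 0}.Nonempty := by
      obtain ⟨b, hb⟩ := Function.ne_iff.1 hne
      rcases hcover b with h | ⟨c, hc⟩
      · exact absurd (hs b h) hb
      · exact ⟨c, b, hc, hb⟩
    obtain ⟨c, ⟨b, hcb, hb⟩, hmin⟩ :=
      Set.exists_min_image _ wC (Set.toFinite {c | ∃ b, RC c b ∧ s b ≠ 0}) hex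
    have hsum := hs_ker c
    rw [Finset.sum_eq_single b] at hsum
    · exact mul_ne_zero hb (hC hcb) hsum
    · intro b' _ hb'
      by_contra hprod
      obtain ⟨hsb', hNb'⟩ := mul_ne_zero_iff.1 hprod
      rcases hcover b' with h | ⟨c', hc'⟩
      · exact hsb' (hs b' h)
      · by_cases hcc : c = c'
        · subst hcc
          exact hb' (hCuniq hc' hcb)
        · exact (hmin c' ⟨b', hc', hsb'⟩).not_gt (hClt hc' hNb' hcc)
    · simp
  simpa [hs0] using hr

/-- The block with index `i` of the ordered set partition encoded by `F`. -/
def fiber {n : ℕ} (F : Fin n → ℕ) (i : ℕ) : Finset (Fin n) := Finset.univ.filter (F · = i)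

/-- The largest element of the block with index `i`. -/
def fiberMax {n : ℕ} (F : Fin n → ℕ) (i : ℕ) : ℕ := (fiber F i).sup Fin.val

/-- Merging of the blocks `j` and `j + 1`, on natural-number indices. -/
def mergeNat (j x : ℕ) : ℕ := if x ≤ j then x else x - 1

/-- The block weights which, compared lexicographically, make the matching acyclic. -/
def fiberWeight {n : ℕ} (k : ℕ) (F : Fin n → ℕ) (i : ℕ) : ℕ :=
  3 * fiberMax F i + if (fiber F i).card = k then 0 else if (fiber F i).card = 1 then 2 else 1

/-- `G` arises from `F` by splitting off the maximum of block `i`, the first block of `F` whose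
size is neither `1` nor `k`; no earlier block of `G` can be merged back in this way. -/
structure IsSplit {n : ℕ} (k : ℕ) (F G : Fin n → ℕ) (i : ℕ) : Prop where
  eq_merge : F = mergeNat i ∘ G
  card_eq_one : (fiber G i).card = 1
  nonempty_succ : (fiber G (i + 1)).Nonempty
  max_lt : fiberMax G (i + 1) < fiberMax G i
  card_ne : (fiber F i).card ≠ k
  inactive : ∀ q < i, (fiber G q).card = k ∨
    (fiber G q).card = 1 ∧ fiberMax G q < fiberMax G (q + 1)

section Fiber

variable {n k : ℕ} {F G G' : Fin n → ℕ} {i j q : ℕ}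

theorem mem_fiber {x : Fin n} : x ∈ fiber F i ↔ F x = i := by simp [fiber]

theorem disjoint_fiber (h : i ≠ j) : Disjoint (fiber F i) (fiber F j) := by
  rw [Finset.disjoint_left]
  intro x hx hy
  exact h ((mem_fiber.1 hx).symm.trans (mem_fiber.1 hy))

theorem fiber_merge_of_lt (h : q < j) : fiber (mergeNat j ∘ G) q = fiber G q := by
  ext x
  simp only [mem_fiber, comp_apply, mergeNat]
  split_ifs <;> omega

theorem fiber_merge_self : fiber (mergeNat j ∘ G) j = fiber G j ∪ fiber G (j + 1) := by
  ext x
  simp only [mem_fiber, comp_apply, mergeNat, Finset.mem_union]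
  split_ifs <;> omega

theorem fiber_merge_of_gt (h : j < q) : fiber (mergeNat j ∘ G) q = fiber G (q + 1) := by
  ext x
  simp only [mem_fiber, comp_apply, mergeNat]
  split_ifs <;> omega

theorem card_fiber_merge_self :
    (fiber (mergeNat j ∘ G) j).card = (fiber G j).card + (fiber G (j + 1)).card := by
  rw [fiber_merge_self, Finset.card_union_of_disjoint (disjoint_fiber (by omega))]

theorem fiberMax_merge_self :
    fiberMax (mergeNat j ∘ G) j = max (fiberMax G j) (fiberMax G (j + 1)) := by
  rw [fiberMax, fiber_merge_self, Finset.sup_union]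
  rfl

theorem exists_mem_fiber_eq_max (h : (fiber F i).Nonempty) :
    ∃ x ∈ fiber F i, (x : ℕ) = fiberMax F i := by
  obtain ⟨x, hx, hx'⟩ := Finset.exists_mem_eq_sup _ h Fin.val
  exact ⟨x, hx, hx'.symm⟩

theorem le_fiberMax {x : Fin n} (h : F x = i) : (x : ℕ) ≤ fiberMax F i :=
  Finset.le_sup (f := Fin.val) (mem_fiber.2 h)

theorem fiberMax_ne (h : i ≠ j) (hi : (fiber F i).Nonempty) (hj : (fiber F j).Nonempty) :
    fiberMax F i ≠ fiberMax F j := by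
  obtain ⟨x, hx, hx'⟩ := exists_mem_fiber_eq_max hi
  obtain ⟨y, hy, hy'⟩ := exists_mem_fiber_eq_max hj
  intro he
  have hxy : x = y := Fin.ext (by omega)
  subst hxy
  exact Finset.disjoint_left.1 (disjoint_fiber h) hx hy

theorem IsSplit.weight_lt (h : IsSplit k F G i) (hk : 2 ≤ k) (hij : j ≠ i)
    (hj : (fiber G (j + 1)).Nonempty) :
    toLex (fiberWeight k F) < toLex (fiberWeight k (mergeNat j ∘ G)) := by
  obtain ⟨rfl, hone, hne, hmax, hcard, hin⟩ := h
  rcases lt_or_gt_of_ne hij with hlt | hgt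
  · refine ⟨j, fun q hq => ?_, ?_⟩
    · simp [fiberWeight, fiberMax, fiber_merge_of_lt hq, fiber_merge_of_lt (hq.trans hlt)]
    · have h1 : fiberMax (mergeNat i ∘ G) j = fiberMax G j := by
        rw [fiberMax, fiber_merge_of_lt hlt]; rfl
      have hpos := hj.card_pos
      change fiberWeight k (mergeNat i ∘ G) j < fiberWeight k (mergeNat j ∘ G) j
      simp only [fiberWeight, h1, fiber_merge_of_lt hlt, fiberMax_merge_self,
        card_fiber_merge_self]
      rcases hin j hlt with hc | ⟨hc, hm⟩
      · rw [if_pos hc, if_neg (by omega), if_neg (by omega)]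
        have := le_max_left (fiberMax G j) (fiberMax G (j + 1))
        omega
      · rw [if_neg (by omega), if_pos hc, max_eq_right hm.le]
        omega
  · refine ⟨i, fun q hq => ?_, ?_⟩
    · simp [fiberWeight, fiberMax, fiber_merge_of_lt hq, fiber_merge_of_lt (hq.trans hgt)]
    · have h1 : fiberMax (mergeNat j ∘ G) i = fiberMax G i := by
        rw [fiberMax, fiber_merge_of_lt hgt]; rfl
      have hpos := hne.card_pos
      have h2 := card_fiber_merge_self (j := i) (G := G)
      change fiberWeight k (mergeNat i ∘ G) i < fiberWeight k (mergeNat j ∘ G) i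
      simp only [fiberWeight, h1, fiber_merge_of_lt hgt, fiberMax_merge_self]
      rw [if_neg hcard, if_neg (by omega), if_neg (by omega), if_pos hone, max_eq_left hmax.le]
      omega

theorem IsSplit.card_of_lt (h : IsSplit k F G i) (hq : q < i) :
    (fiber F q).card = k ∨ (fiber F q).card = 1 := by
  rw [h.eq_merge, fiber_merge_of_lt hq]
  exact (h.inactive q hq).imp_right And.left

theorem IsSplit.two_le_card (h : IsSplit k F G i) : 2 ≤ (fiber F i).card := by
  have h1 := h.nonempty_succ.card_pos
  have h2 := h.card_eq_one
  rw [h.eq_merge, card_fiber_merge_self]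
  omega

theorem IsSplit.index_unique (h : IsSplit k F G i) (h' : IsSplit k F G' j) : i = j := by
  by_contra hne
  rcases lt_or_gt_of_ne hne with hlt | hlt
  · have := h.card_ne
    have := h.two_le_card
    have := h'.card_of_lt hlt
    omega
  · have := h'.card_ne
    have := h'.two_le_card
    have := h.card_of_lt hlt
    omega

theorem IsSplit.eq_ite (h : IsSplit k F G i) (x : Fin n) :
    G x = if F x < i ∨ F x = i ∧ (x : ℕ) = fiberMax F i then F x else F x + 1 := by
  have hF : F x = mergeNat i (G x) := congrFun h.eq_merge x
  have hmaxF : fiberMax F i = fiberMax G i := by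
    rw [h.eq_merge, fiberMax_merge_self, max_eq_left h.max_lt.le]
  have key : G x = i → (x : ℕ) = fiberMax G i := by
    intro hx
    obtain ⟨y, hy⟩ := Finset.card_eq_one.1 h.card_eq_one
    have hxy : x = y := by simpa [hy] using mem_fiber.2 hx
    rw [fiberMax, hy, Finset.sup_singleton, hxy]
  have key' : G x = i + 1 → (x : ℕ) ≠ fiberMax G i := fun hx =>
    ((le_fiberMax hx).trans_lt h.max_lt).ne
  rw [hF, hmaxF]
  unfold mergeNat
  split_ifs <;> grind

theorem IsSplit.unique (h : IsSplit k F G i) (h' : IsSplit k F G' j) : G = G' := by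
  obtain rfl := h.index_unique h'
  funext x
  rw [h.eq_ite, h'.eq_ite]

end Fiber

/-- `F` encodes an ordered set partition into `m` blocks, one of which has at least `k` elements. -/
structure IsFace {n : ℕ} (k m : ℕ) (F : Fin n → ℕ) : Prop where
  lt : ∀ x, F x < m
  nonempty : ∀ i < m, (fiber F i).Nonempty
  big : ∃ i, k ≤ (fiber F i).card

section Face

variable {n k m : ℕ} {F G : Fin n → ℕ} {i j : ℕ}

theorem card_fiber_add_card_fiber_le (h : i ≠ j) : (fiber F i).card + (fiber F j).card ≤ n := by
  rw [← Finset.card_union_of_disjoint (disjoint_fiber h)]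
  exact (Finset.card_le_univ _).trans_eq (Fintype.card_fin n)

theorem IsFace.lt_of_fiber_nonempty (hF : IsFace k m F) (h : (fiber F i).Nonempty) : i < m := by
  obtain ⟨x, hx⟩ := h
  exact mem_fiber.1 hx ▸ hF.lt x

theorem IsFace.sum_card_fiber (hF : IsFace k m F) :
    ∑ i ∈ Finset.range m, (fiber F i).card = n := by
  have h := Finset.card_eq_sum_card_fiberwise (s := (Finset.univ : Finset (Fin n)))
    (t := Finset.range m) (f := F) (fun x _ => by simpa using hF.lt x)
  simpa [fiber] using h.symm

theorem IsFace.add_le (hF : IsFace k (m + 1) F) (hk : 0 < k) : k + m ≤ n := by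
  obtain ⟨c, hc⟩ := hF.big
  have hcm : c < m + 1 := hF.lt_of_fiber_nonempty (Finset.card_pos.1 (hk.trans_le hc))
  have hmem := Finset.mem_range.2 hcm
  have hsum := hF.sum_card_fiber
  rw [← Finset.add_sum_erase _ _ hmem] at hsum
  have hrest := Finset.card_nsmul_le_sum ((Finset.range (m + 1)).erase c)
    (fun i => (fiber F i).card) 1 fun i hi =>
      (hF.nonempty i (Finset.mem_range.1 (Finset.mem_of_mem_erase hi))).card_pos
  rw [Finset.card_erase_of_mem hmem, Finset.card_range, smul_eq_mul, mul_one] at hrest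
  omega

theorem IsFace.exists_card_ne (hF : IsFace k (m + 1) F) (hk : 2 ≤ k) (hn : n < 2 * k)
    (hm : m < n - k) : ∃ i < m + 1, (fiber F i).card ≠ 1 ∧ (fiber F i).card ≠ k := by
  by_contra! hall
  obtain ⟨c, hc⟩ := hF.big
  have hcm : c < m + 1 := hF.lt_of_fiber_nonempty (Finset.card_pos.1 (by omega))
  have hck : (fiber F c).card = k := hall c hcm (by omega)
  have hmem := Finset.mem_range.2 hcm
  have hsum := hF.sum_card_fiber
  have hone : ∀ i ∈ (Finset.range (m + 1)).erase c, (fiber F i).card = 1 := by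
    intro i hi
    by_contra h1
    have h2 := hall i (Finset.mem_range.1 (Finset.mem_of_mem_erase hi)) h1
    have h3 := card_fiber_add_card_fiber_le (F := F) (Finset.ne_of_mem_erase hi)
    omega
  rw [← Finset.add_sum_erase _ _ hmem, Finset.sum_congr rfl hone] at hsum
  simp [Finset.card_erase_of_mem hmem] at hsum
  omega

theorem IsFace.merge (hF : IsFace k (m + 1) F) (hj : j < m) : IsFace k m (mergeNat j ∘ F) := by
  refine ⟨fun x => ?_, fun i hi => ?_, ?_⟩
  · have := hF.lt x
    simp only [comp_apply, mergeNat]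
    split_ifs <;> omega
  · rcases lt_trichotomy i j with h | rfl | h
    · rw [fiber_merge_of_lt h]
      exact hF.nonempty i (by omega)
    · rw [fiber_merge_self]
      exact (hF.nonempty i (by omega)).mono Finset.subset_union_left
    · rw [fiber_merge_of_gt h]
      exact hF.nonempty _ (by omega)
  · obtain ⟨c, hc⟩ := hF.big
    rcases lt_trichotomy c j with h | rfl | h
    · exact ⟨c, by rwa [fiber_merge_of_lt h]⟩
    · exact ⟨c, by rw [card_fiber_merge_self]; omega⟩
    · rcases Nat.lt_or_ge (j + 1) c with h' | h'
      · refine ⟨c - 1, ?_⟩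
        rw [fiber_merge_of_gt (by omega), Nat.sub_add_cancel (by omega)]
        exact hc
      · obtain rfl : c = j + 1 := by omega
        exact ⟨j, by rw [card_fiber_merge_self]; omega⟩

/-- Splitting the maximum off block `i`. -/
def splitMax {n : ℕ} (F : Fin n → ℕ) (i : ℕ) (x : Fin n) : ℕ :=
  if F x < i ∨ F x = i ∧ (x : ℕ) = fiberMax F i then F x else F x + 1

theorem merge_splitMax : mergeNat i ∘ splitMax F i = F := by
  funext x
  simp only [comp_apply, mergeNat, splitMax]
  split_ifs <;> omega

theorem fiber_splitMax_of_lt (h : j < i) : fiber (splitMax F i) j = fiber F j := by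
  rw [← fiber_merge_of_lt h, merge_splitMax]

theorem fiber_splitMax_of_gt (h : i < j) : fiber (splitMax F i) (j + 1) = fiber F j := by
  rw [← fiber_merge_of_gt h, merge_splitMax]

theorem card_fiber_splitMax_self (h : (fiber F i).Nonempty) :
    (fiber (splitMax F i) i).card = 1 := by
  obtain ⟨y, hy, hy'⟩ := exists_mem_fiber_eq_max h
  refine Finset.card_eq_one.2 ⟨y, ?_⟩
  ext x
  rw [mem_fiber] at hy ⊢
  simp only [splitMax, Finset.mem_singleton, Fin.ext_iff]
  split_ifs with hx
  · rcases hx with hx | hx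
    · exact ⟨fun h => by omega, fun h => by rw [← Fin.ext_iff] at h; subst h; omega⟩
    · omega
  · exact ⟨fun h => by omega, fun h => by rw [← Fin.ext_iff] at h; subst h; omega⟩

theorem card_fiber_splitMax_succ (h : (fiber F i).Nonempty) :
    (fiber (splitMax F i) (i + 1)).card + 1 = (fiber F i).card := by
  have h1 := card_fiber_merge_self (j := i) (G := splitMax F i)
  rw [merge_splitMax, card_fiber_splitMax_self h] at h1
  omega

theorem fiberMax_splitMax_self : fiberMax (splitMax F i) i = fiberMax F i := by
  rcases (fiber F i).eq_empty_or_nonempty with h | h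
  · have h1 := fiber_merge_self (j := i) (G := splitMax F i)
    rw [merge_splitMax, h] at h1
    rw [fiberMax, fiberMax, h, (Finset.union_eq_empty.1 h1.symm).1]
  · obtain ⟨y, hy, hy'⟩ := exists_mem_fiber_eq_max h
    have hle := fiberMax_merge_self (j := i) (G := splitMax F i)
    rw [merge_splitMax] at hle
    have hyi : splitMax F i y = i := by
      rw [splitMax, if_pos (Or.inr ⟨mem_fiber.1 hy, hy'⟩), mem_fiber.1 hy]
    have := le_fiberMax hyi
    omega

theorem fiberMax_splitMax_succ_lt (h : 2 ≤ (fiber F i).card) :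
    fiberMax (splitMax F i) (i + 1) < fiberMax (splitMax F i) i := by
  have hne : (fiber F i).Nonempty := Finset.card_pos.1 (by omega)
  have h1 := card_fiber_splitMax_succ hne
  have h2 := card_fiber_splitMax_self hne
  have h3 := fiberMax_ne (F := splitMax F i) (by omega : i + 1 ≠ i) (Finset.card_pos.1 (by omega))
    (Finset.card_pos.1 (by omega))
  have h4 := fiberMax_merge_self (j := i) (G := splitMax F i)
  rw [merge_splitMax, ← fiberMax_splitMax_self] at h4
  have h5 := le_max_right (fiberMax (splitMax F i) i) (fiberMax (splitMax F i) (i + 1))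
  exact lt_of_le_of_ne (by omega) h3

theorem IsFace.splitMax (hF : IsFace k m F) (hi : i < m) (h2 : 2 ≤ (fiber F i).card)
    (hk : (fiber F i).card ≠ k) : IsFace k (m + 1) (splitMax F i) := by
  have hne := hF.nonempty i hi
  refine ⟨fun x => ?_, fun j hj => ?_, ?_⟩
  · have := hF.lt x
    rw [_root_.splitMax]
    split_ifs <;> omega
  · rcases lt_trichotomy j i with h | rfl | h
    · rw [fiber_splitMax_of_lt h]
      exact hF.nonempty j (by omega)
    · exact Finset.card_pos.1 (by rw [card_fiber_splitMax_self hne]; omega)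
    · obtain ⟨j, rfl⟩ := Nat.exists_eq_add_one_of_ne_zero (n := j) (by omega)
      rcases Nat.lt_or_ge i j with h' | h'
      · rw [fiber_splitMax_of_gt h']
        exact hF.nonempty j (by omega)
      · obtain rfl : j = i := by omega
        have := card_fiber_splitMax_succ hne
        exact Finset.card_pos.1 (by omega)
  · obtain ⟨c, hc⟩ := hF.big
    rcases lt_trichotomy c i with h | rfl | h
    · exact ⟨c, by rwa [fiber_splitMax_of_lt h]⟩
    · have := card_fiber_splitMax_succ hne
      exact ⟨c + 1, by omega⟩
    · exact ⟨c + 1, by rwa [fiber_splitMax_of_gt h]⟩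

theorem IsFace.exists_isSplit (hF : IsFace k (m + 1) F) (hk : 2 ≤ k) (hn : n < 2 * k)
    (hm : m < n - k) :
    (∃ G, ∃ i < m + 1, IsFace k (m + 2) G ∧ IsSplit k F G i) ∨
      ∃ G, ∃ i < m, IsFace k m G ∧ IsSplit k G F i := by
  classical
  have hex : ∃ i, i < m + 1 ∧ (((fiber F i).card ≠ 1 ∧ (fiber F i).card ≠ k) ∨
      ((fiber F i).card = 1 ∧ i + 1 < m + 1 ∧ fiberMax F (i + 1) < fiberMax F i)) := by
    obtain ⟨i, hi, h⟩ := hF.exists_card_ne hk hn hm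
    exact ⟨i, hi, Or.inl h⟩
  obtain ⟨i, ⟨hi, hact⟩, hmin⟩ : ∃ i, (i < m + 1 ∧ (((fiber F i).card ≠ 1 ∧ (fiber F i).card ≠ k) ∨
      ((fiber F i).card = 1 ∧ i + 1 < m + 1 ∧ fiberMax F (i + 1) < fiberMax F i))) ∧
      ∀ q < i, ¬ (q < m + 1 ∧ (((fiber F q).card ≠ 1 ∧ (fiber F q).card ≠ k) ∨
      ((fiber F q).card = 1 ∧ q + 1 < m + 1 ∧ fiberMax F (q + 1) < fiberMax F q))) :=
    ⟨Nat.find hex, Nat.find_spec hex, fun q hq => Nat.find_min hex hq⟩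
  have hin : ∀ q < i, (fiber F q).card = k ∨
      (fiber F q).card = 1 ∧ fiberMax F q < fiberMax F (q + 1) := by
    intro q hq
    have h1 := hmin q hq
    have h2 := fiberMax_ne (F := F) (Nat.succ_ne_self q) (hF.nonempty _ (by omega))
      (hF.nonempty q (by omega))
    by_cases h3 : (fiber F q).card = k
    · exact Or.inl h3
    · by_cases h4 : (fiber F q).card = 1
      · exact Or.inr ⟨h4, by grind⟩
      · exact absurd ⟨by omega, Or.inl ⟨h4, h3⟩⟩ h1
  rcases hact with ⟨h1, h2⟩ | ⟨h1, h2, h3⟩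
  · left
    have hne := hF.nonempty i hi
    have hcard : 2 ≤ (fiber F i).card := by have := hne.card_pos; omega
    refine ⟨_root_.splitMax F i, i, hi, hF.splitMax hi hcard h2, merge_splitMax.symm,
      card_fiber_splitMax_self hne, ?_, fiberMax_splitMax_succ_lt hcard, h2, fun q hq => ?_⟩
    · have := card_fiber_splitMax_succ hne
      exact Finset.card_pos.1 (by omega)
    · rw [fiber_splitMax_of_lt hq]
      refine (hin q hq).imp_right fun h => ⟨h.1, ?_⟩
      rcases Nat.lt_or_ge (q + 1) i with h' | h'
      · simpa [fiberMax, fiber_splitMax_of_lt hq, fiber_splitMax_of_lt h'] using h.2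
      · obtain rfl : i = q + 1 := by omega
        rw [fiberMax_splitMax_self]
        simpa [fiberMax, fiber_splitMax_of_lt hq] using h.2
  · right
    have hG := hF.merge (j := i) (by omega)
    refine ⟨mergeNat i ∘ F, i, by omega, hG, rfl, h1, hF.nonempty _ h2, h3, ?_, hin⟩
    intro hcard
    rw [card_fiber_merge_self, h1] at hcard
    obtain ⟨c, hc⟩ := hF.big
    have hci : c ≠ i := by rintro rfl; omega
    have hci' : c ≠ i + 1 := by rintro rfl; omega
    have hdisj : Disjoint (fiber F c) (fiber (mergeNat i ∘ F) i) := by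
      rw [fiber_merge_self]
      exact Finset.disjoint_union_right.2 ⟨disjoint_fiber hci, disjoint_fiber hci'⟩
    have hle := (Finset.card_le_univ (fiber F c ∪ fiber (mergeNat i ∘ F) i)).trans_eq
      (Fintype.card_fin n)
    rw [Finset.card_union_of_disjoint hdisj, card_fiber_merge_self, h1] at hle
    omega

end Face

section Complex

variable {n k m : ℕ}

theorem val_mergeMap (j : Fin m) (x : Fin (m + 1)) : (mergeMap j x : ℕ) = mergeNat j x := by
  simp only [mergeMap, mergeNat]
  split_ifs <;> rfl

theorem val_comp_mergeMap (j : Fin m) (f : Fin n → Fin (m + 1)) :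
    (fun x => ((mergeMap j ∘ f) x : ℕ)) = mergeNat j ∘ fun x => (f x : ℕ) :=
  funext fun x => val_mergeMap j (f x)

theorem mergeMap_comp_mergeMap (i : Fin m) (j : Fin (m + 1)) (h : (i : ℕ) < j) :
    mergeMap i ∘ mergeMap j = mergeMap ⟨(j : ℕ) - 1, by omega⟩ ∘ mergeMap i.castSucc := by
  funext x
  apply Fin.ext
  simp only [comp_apply, val_mergeMap, Fin.val_castSucc, mergeNat]
  split_ifs <;> omega

theorem completeIn_iff (hk : 0 < k) (f : Fin n → Fin m) :
    completeIn n k m f ↔ ∃ i, k ≤ (fiber (fun x => (f x : ℕ)) i).card := by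
  constructor
  · rintro ⟨e, he, i, hi⟩
    refine ⟨i, he ▸ Finset.card_le_card fun x hx => ?_⟩
    simp [mem_fiber, hi x hx]
  · rintro ⟨i, hi⟩
    obtain ⟨e, hsub, he⟩ := Finset.exists_subset_card_eq hi
    obtain ⟨y, hy⟩ := Finset.card_pos.1 (he ▸ hk)
    exact ⟨e, he, f y, fun x hx =>
      Fin.ext ((mem_fiber.1 (hsub hx)).trans (mem_fiber.1 (hsub hy)).symm)⟩

theorem LamBas.isFace (hk : 0 < k) (f : LamBas n (completeIn n k) m) :
    IsFace k m (fun x => (f.1 x : ℕ)) := by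
  refine ⟨fun x => (f.1 x).isLt, fun i hi => ?_, (completeIn_iff hk _).1 f.2.2⟩
  obtain ⟨x, hx⟩ := f.2.1 ⟨i, hi⟩
  exact ⟨x, mem_fiber.2 (by simp [hx])⟩

theorem IsFace.exists_lamBas {F : Fin n → ℕ} (hF : IsFace k m F) (hk : 0 < k) :
    ∃ f : LamBas n (completeIn n k) m, (fun x => (f.1 x : ℕ)) = F := by
  refine ⟨⟨fun x => ⟨F x, hF.lt x⟩, fun i => ?_, (completeIn_iff hk _).2 hF.big⟩, rfl⟩
  obtain ⟨x, hx⟩ := hF.nonempty i i.isLt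
  exact ⟨x, Fin.ext ((mem_fiber (F := F)).1 hx)⟩

theorem LamBas.ext_val {P : (m : ℕ) → (Fin n → Fin m) → Prop} {f g : LamBas n P m}
    (h : (fun x => (f.1 x : ℕ)) = fun x => (g.1 x : ℕ)) : f = g :=
  Subtype.ext (funext fun x => Fin.ext (congrFun h x))

theorem LamBas.exists_merge (hk : 0 < k) (f : LamBas n (completeIn n k) (m + 1)) (j : Fin m) :
    ∃ g : LamBas n (completeIn n k) m, mergeMap j ∘ f.1 = g.1 := by
  obtain ⟨g, hg⟩ := ((f.isFace hk).merge j.isLt).exists_lamBas hk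
  rw [← val_comp_mergeMap] at hg
  exact ⟨g, (funext fun x => Fin.ext (congrFun hg x)).symm⟩

/-- The cell `a` is matched with the cell `f` of one dimension less. -/
def IsMatched (f : LamBas n (completeIn n k) m) (a : LamBas n (completeIn n k) (m + 1)) : Prop :=
  ∃ i : Fin m, IsSplit k (fun x => (f.1 x : ℕ)) (fun x => (a.1 x : ℕ)) i

theorem lamMat_ne_zero_of_isMatched (hk : 2 ≤ k) {f : LamBas n (completeIn n k) m}
    {a : LamBas n (completeIn n k) (m + 1)} (h : IsMatched f a) :
    lamMat n (completeIn n k) m a f ≠ 0 := by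
  obtain ⟨i, hi⟩ := h
  have hia : mergeMap i ∘ a.1 = f.1 :=
    funext fun x => Fin.ext ((congrFun (val_comp_mergeMap i a.1) x).trans
      (congrFun hi.eq_merge x).symm)
  rw [lamMat, Finset.sum_eq_single i]
  · simp [hia]
  · intro j _ hj
    rw [if_neg, mul_zero]
    intro hja
    have hlt := hi.weight_lt hk (Fin.val_ne_of_ne hj)
      ((a.isFace (by omega)).nonempty _ (by omega))
    rw [← val_comp_mergeMap, hja] at hlt
    exact lt_irrefl _ hlt
  · simp

theorem weight_lt_of_lamMat_ne_zero (hk : 2 ≤ k) {f g : LamBas n (completeIn n k) m}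
    {a : LamBas n (completeIn n k) (m + 1)} (h : IsMatched f a)
    (hg : lamMat n (completeIn n k) m a g ≠ 0) (hne : g ≠ f) :
    toLex (fiberWeight k fun x => (f.1 x : ℕ)) < toLex (fiberWeight k fun x => (g.1 x : ℕ)) := by
  obtain ⟨i, hi⟩ := h
  obtain ⟨j, -, hj⟩ := Finset.exists_ne_zero_of_sum_ne_zero hg
  have hja : mergeMap j ∘ a.1 = g.1 := by
    by_contra h0
    simp [h0] at hj
  have hgv : (fun x => (g.1 x : ℕ)) = mergeNat j ∘ fun x => (a.1 x : ℕ) := by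
    rw [← val_comp_mergeMap, hja]
  rw [hgv]
  refine hi.weight_lt hk (fun hij => hne ?_) ((a.isFace (by omega)).nonempty _ (by omega))
  apply LamBas.ext_val
  rw [hgv, hi.eq_merge, hij]

theorem lamMat_mul_lamMat (hk : 0 < k) (a : LamBas n (completeIn n k) (m + 2))
    (c : LamBas n (completeIn n k) m) :
    ∑ b, lamMat n (completeIn n k) (m + 1) a b * lamMat n (completeIn n k) m b c = 0 := by
  have hpair : ∑ b, lamMat n (completeIn n k) (m + 1) a b * lamMat n (completeIn n k) m b c =
      ∑ p : Fin (m + 1) × Fin m, (-1 : ℚ) ^ ((p.1 : ℕ) + p.2) *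
        (if mergeMap p.2 ∘ mergeMap p.1 ∘ a.1 = c.1 then 1 else 0) := by
    rw [Fintype.sum_prod_type]
    simp_rw [lamMat, Finset.sum_mul]
    rw [Finset.sum_comm]
    refine Finset.sum_congr rfl fun j _ => ?_
    obtain ⟨g, hg⟩ := a.exists_merge hk j
    rw [Finset.sum_eq_single g]
    · rw [if_pos hg, mul_one, Finset.mul_sum]
      refine Finset.sum_congr rfl fun i _ => ?_
      simp only [hg]
      ring
    · intro b _ hb
      rw [if_neg, mul_zero, zero_mul]
      intro h
      exact hb (Subtype.ext (h.symm.trans hg))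
    · simp
  rw [hpair]
  refine Finset.sum_involution
    (fun p _ => if h : (p.2 : ℕ) < p.1 then (p.2.castSucc, ⟨(p.1 : ℕ) - 1, by omega⟩)
      else (p.2.succ, ⟨p.1, by omega⟩)) ?_ ?_ (fun _ _ => Finset.mem_univ _) ?_
  · rintro ⟨j, i⟩ -
    by_cases h : (i : ℕ) < j
    · have hm := mergeMap_comp_mergeMap i j h
      simp only [h, dif_pos, ← comp_assoc, ← hm, Fin.val_castSucc, ← add_mul]
      obtain ⟨j', hj'⟩ := Nat.exists_eq_add_one_of_ne_zero (n := (j : ℕ)) (by omega)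
      rw [hj']
      simp only [Nat.add_sub_cancel]
      ring
    · have hm := mergeMap_comp_mergeMap (⟨j, by omega⟩ : Fin m) i.succ
        (by simp only [Fin.val_succ]; omega)
      simp only [Fin.val_succ, Nat.add_sub_cancel, Fin.eta] at hm
      have hj : (Fin.castSucc ⟨(j : ℕ), by omega⟩ : Fin (m + 1)) = j := rfl
      rw [hj] at hm
      simp only [h, dif_neg, not_false_eq_true, ← comp_assoc, hm, Fin.val_succ, ← add_mul]
      ring
  · rintro ⟨j, i⟩ - -
    by_cases h : (i : ℕ) < j <;> simp [h, Fin.ext_iff] <;> omega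
  · rintro ⟨j, i⟩ -
    by_cases h : (i : ℕ) < j
    · simp [h]
      grind
    · have h' : (j : ℕ) < i + 1 := by omega
      simp [h, h']

theorem ker_lamBnd_le_range (hk : 2 ≤ k) (hn : n < 2 * k) (hm : m < n - k) :
    LinearMap.ker (lamBnd n (completeIn n k) m) ≤
      LinearMap.range (lamBnd n (completeIn n k) (m + 1)) := by
  refine ker_matLin_le_range_of_matching (lamMat_mul_lamMat (by omega))
    (wB := fun f => toLex (fiberWeight k fun x => (f.1 x : ℕ)))
    (wC := fun f => toLex (fiberWeight k fun x => (f.1 x : ℕ)))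
    (RB := IsMatched) (RC := IsMatched)
    (lamMat_ne_zero_of_isMatched hk) (weight_lt_of_lamMat_ne_zero hk)
    (lamMat_ne_zero_of_isMatched hk) (weight_lt_of_lamMat_ne_zero hk) ?_ ?_
  · rintro c b b' ⟨i, hi⟩ ⟨i', hi'⟩
    exact LamBas.ext_val (hi.unique hi')
  · intro b
    rcases (b.isFace (by omega)).exists_isSplit hk hn hm with ⟨G, i, hi, hG, hs⟩ | ⟨G, i, hi, hG, hs⟩
    · obtain ⟨g, rfl⟩ := hG.exists_lamBas (by omega)
      exact Or.inl ⟨g, ⟨i, hi⟩, hs⟩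
    · obtain ⟨g, rfl⟩ := hG.exists_lamBas (by omega)
      exact Or.inr ⟨g, ⟨i, hi⟩, hs⟩

theorem range_lamBnd_le_ker (hk : 0 < k) :
    LinearMap.range (lamBnd n (completeIn n k) (m + 1)) ≤
      LinearMap.ker (lamBnd n (completeIn n k) m) := by
  rintro _ ⟨t, rfl⟩
  rw [LinearMap.mem_ker]
  funext c
  change ∑ b, (∑ a, t a * lamMat n (completeIn n k) (m + 1) a b) *
    lamMat n (completeIn n k) m b c = 0
  simp_rw [Finset.sum_mul, mul_assoc]
  rw [Finset.sum_comm]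
  simp_rw [← Finset.mul_sum, lamMat_mul_lamMat hk, mul_zero, Finset.sum_const_zero]

theorem isEmpty_lamBas (hk : 0 < k) (h : n < k + m) :
    IsEmpty (LamBas n (completeIn n k) (m + 1)) :=
  ⟨fun f => h.not_ge ((f.isFace hk).add_le hk)⟩

theorem finrank_homology_eq_zero (hk : 2 ≤ k) (hn : n < 2 * k) (hm : m ≠ n - k) (hkn : k ≤ n) :
    Module.finrank ℚ (homologyOf (lamBnd n (completeIn n k) (m + 1))
      (lamBnd n (completeIn n k) m)) = 0 := by
  have hle : LinearMap.ker (lamBnd n (completeIn n k) m) ≤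
      LinearMap.range (lamBnd n (completeIn n k) (m + 1)) := by
    rcases lt_or_gt_of_ne hm with h | h
    · exact ker_lamBnd_le_range hk hn h
    · have := isEmpty_lamBas (n := n) (m := m) (k := k) (by omega) (by omega)
      intro x _
      rw [Subsingleton.elim x 0]
      exact zero_mem _
  have : Subsingleton (homologyOf (lamBnd n (completeIn n k) (m + 1))
      (lamBnd n (completeIn n k) m)) :=
    Submodule.Quotient.subsingleton_iff.2 (Submodule.comap_subtype_eq_top.2 hle)
  exact Module.finrank_zero_of_subsingleton

theorem card_lamBas_succ (hk : 2 ≤ k) (hn : n < 2 * k) (hm : m < n - k) :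
    Fintype.card (LamBas n (completeIn n k) (m + 1)) =
      Module.finrank ℚ (LinearMap.range (lamBnd n (completeIn n k) m)) +
        Module.finrank ℚ (LinearMap.range (lamBnd n (completeIn n k) (m + 1))) := by
  rw [← Module.finrank_fintype_fun_eq_card ℚ,
    ← LinearMap.finrank_range_add_finrank_ker (lamBnd n (completeIn n k) m),
    le_antisymm (ker_lamBnd_le_range hk hn hm) (range_lamBnd_le_ker (by omega))]

theorem finrank_range_lamBnd (hk : 2 ≤ k) (hn : n < 2 * k) (hkn : k < n) (hm : m ≤ n - k) :
    (Module.finrank ℚ (LinearMap.range (lamBnd n (completeIn n k) m)) : ℚ) =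
      (-1) ^ m * ∑ i ∈ Finset.range (m + 1),
        (-1) ^ i * (Fintype.card (LamBas n (completeIn n k) i) : ℚ) := by
  induction m with
  | zero =>
    have : IsEmpty (LamBas n (completeIn n k) 0) := ⟨fun f => (f.1 ⟨0, by omega⟩).elim0⟩
    have h := (Submodule.finrank_le (LinearMap.range (lamBnd n (completeIn n k) 0)))
    rw [Module.finrank_fintype_fun_eq_card, Fintype.card_eq_zero] at h
    simp [Nat.le_zero.1 h]
  | succ m ih =>
    have h1 := card_lamBas_succ hk hn (show m < n - k by omega)
    have h2 := ih (by omega)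
    have h3 : (-1 : ℚ) ^ (m + 1) * (-1) ^ (m + 1) = 1 := by
      rw [← pow_add, Even.neg_one_pow ⟨m + 1, rfl⟩]
    rw [Finset.sum_range_succ, mul_add, ← mul_assoc, h3, pow_succ (-1 : ℚ) m, mul_neg_one,
      neg_mul, ← h2, h1]
    push_cast
    ring

theorem finrank_homology_top (hk : 2 ≤ k) (hn : n < 2 * k) (hkn : k < n) :
    (Module.finrank ℚ (homologyOf (lamBnd n (completeIn n k) (n - k + 1))
      (lamBnd n (completeIn n k) (n - k))) : ℚ) =
      (-1) ^ (n - k + 1) * ∑ i ∈ Finset.range (n - k + 2),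
        (-1) ^ i * (Fintype.card (LamBas n (completeIn n k) i) : ℚ) := by
  have := isEmpty_lamBas (n := n) (m := n - k + 1) (k := k) (by omega) (by omega)
  have hbot : LinearMap.range (lamBnd n (completeIn n k) (n - k + 1)) = ⊥ :=
    LinearMap.range_eq_bot.2 (LinearMap.ext fun x => by rw [Subsingleton.elim x 0, map_zero, map_zero])
  have hker : Module.finrank ℚ (homologyOf (lamBnd n (completeIn n k) (n - k + 1))
      (lamBnd n (completeIn n k) (n - k))) =
      Module.finrank ℚ (LinearMap.ker (lamBnd n (completeIn n k) (n - k))) := by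
    refine (Submodule.quotEquivOfEqBot _ ?_).finrank_eq
    rw [hbot, Submodule.comap_bot, Submodule.ker_subtype]
  have h1 := LinearMap.finrank_range_add_finrank_ker (lamBnd n (completeIn n k) (n - k))
  rw [Module.finrank_fintype_fun_eq_card] at h1
  have h2 := finrank_range_lamBnd hk hn hkn le_rfl
  have h3 : (-1 : ℚ) ^ (n - k + 1) * (-1) ^ (n - k + 1) = 1 := by
    rw [← pow_add, Even.neg_one_pow ⟨n - k + 1, rfl⟩]
  rw [hker, Finset.sum_range_succ, mul_add, ← mul_assoc, h3, pow_succ (-1 : ℚ) (n - k),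
    mul_neg_one, neg_mul, ← h2, ← h1]
  push_cast
  ring

end Complex

section Counting

variable {n k m c : ℕ}

theorem completeIn_comp_iff {l : ℕ} (hk : 0 < k) {e : Fin m → Fin l} (he : Injective e)
    (f : Fin n → Fin m) : completeIn n k l (e ∘ f) ↔ completeIn n k m f := by
  constructor
  · rintro ⟨s, hs, i, hi⟩
    obtain ⟨y, hy⟩ := Finset.card_pos.1 (hs ▸ hk)
    exact ⟨s, hs, f y, fun x hx => he ((hi x hx).trans (hi y hy).symm)⟩
  · rintro ⟨s, hs, i, hi⟩
    exact ⟨s, hs, e i, fun x hx => congrArg e (hi x hx)⟩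

open scoped Classical in
theorem card_filter_image_eq (hk : 0 < k) (S : Finset (Fin c)) :
    (Finset.univ.filter fun f : Fin n → Fin c =>
      completeIn n k c f ∧ Finset.univ.image f = S).card =
      Fintype.card (LamBas n (completeIn n k) S.card) := by
  symm
  rw [← Finset.card_univ]
  refine Finset.card_bij (fun g _ => S.orderEmbOfFin rfl ∘ g.1) (fun g _ => ?_)
    (fun g _ g' _ h => Subtype.ext ((S.orderEmbOfFin rfl).injective.comp_left h)) (fun f hf => ?_)
  · refine Finset.mem_filter.2 ⟨Finset.mem_univ _,
      (completeIn_comp_iff hk (S.orderEmbOfFin rfl).injective _).2 g.2.2, ?_⟩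
    rw [← Finset.coe_inj, Finset.coe_image, Finset.coe_univ, Set.image_univ,
      g.2.1.range_comp, Finset.range_orderEmbOfFin]
  · obtain ⟨hP, hS⟩ := (Finset.mem_filter.1 hf).2
    have hmem : ∀ x, f x ∈ S := fun x => hS ▸ Finset.mem_image_of_mem f (Finset.mem_univ x)
    have hcomp : S.orderEmbOfFin rfl ∘ (fun x => (S.orderIsoOfFin rfl).symm ⟨f x, hmem x⟩) = f := by
      funext x
      simp [← Finset.coe_orderIsoOfFin_apply]
    refine ⟨⟨fun x => (S.orderIsoOfFin rfl).symm ⟨f x, hmem x⟩, fun i => ?_, ?_⟩,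
      Finset.mem_univ _, hcomp⟩
    · obtain ⟨x, -, hx⟩ := Finset.mem_image.1 (hS.symm.subset (S.orderIsoOfFin rfl i).2)
      exact ⟨x, (OrderIso.symm_apply_eq _).2 (Subtype.ext hx)⟩
    · rwa [← completeIn_comp_iff hk (S.orderEmbOfFin rfl).injective, hcomp]

open scoped Classical in
theorem card_completeIn_eq_sum_choose (hk : 0 < k) :
    (Finset.univ.filter fun f : Fin n → Fin c => completeIn n k c f).card =
      ∑ i ∈ Finset.range (n - k + 2),
        c.choose i * Fintype.card (LamBas n (completeIn n k) i) := by
  rw [Finset.card_eq_sum_card_fiberwise (f := fun f => Finset.univ.image f)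
    (t := (Finset.univ : Finset (Fin c)).powerset) (fun _ _ => by simp)]
  simp_rw [Finset.filter_filter, card_filter_image_eq hk]
  rw [Finset.sum_powerset_apply_card (fun i => Fintype.card (LamBas n (completeIn n k) i)),
    Finset.card_univ, Fintype.card_fin]
  simp_rw [smul_eq_mul]
  have h1 : Finset.range (c + 1) ⊆ Finset.range (c + n + 3) :=
    Finset.range_subset_range.2 (by omega)
  have h2 : Finset.range (n - k + 2) ⊆ Finset.range (c + n + 3) :=
    Finset.range_subset_range.2 (by omega)
  rw [Finset.sum_subset h1, Finset.sum_subset h2]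
  · intro i _ hi
    obtain ⟨i, rfl⟩ := Nat.exists_eq_add_one_of_ne_zero (n := i) (by rintro rfl; simp at hi)
    have := isEmpty_lamBas (n := n) (m := i) (k := k) hk (by simp at hi; omega)
    simp
  · intro i _ hi
    rw [Nat.choose_eq_zero_of_lt (by simpa using hi), zero_mul]

theorem card_filter_ne_eq (j : Fin c) (T : Finset (Fin n)) :
    (Finset.univ.filter fun f : Fin n → Fin c => (Finset.univ.filter (f · ≠ j)) = T).card =
      (c - 1) ^ T.card := by
  have h : (Finset.univ.filter fun f : Fin n → Fin c => (Finset.univ.filter (f · ≠ j)) = T) =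
      Fintype.piFinset fun x => if x ∈ T then Finset.univ.erase j else {j} := by
    ext f
    simp only [Finset.mem_filter, Finset.mem_univ, true_and, Fintype.mem_piFinset, Finset.ext_iff]
    refine forall_congr' fun x => ?_
    split_ifs with hx <;> simp [hx]
  rw [h, Fintype.card_piFinset]
  simp [apply_ite Finset.card, Finset.card_erase_of_mem]

open scoped Classical in
theorem card_completeIn_eq_sum_pow (hn : n < 2 * k) (hkn : k ≤ n) :
    (Finset.univ.filter fun f : Fin n → Fin c => completeIn n k c f).card =
      c * ∑ i ∈ Finset.range (n - k + 1), n.choose i * (c - 1) ^ i := by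
  have hmono : ∀ f : Fin n → Fin c, (if completeIn n k c f then 1 else 0) =
      ∑ j, if (Finset.univ.filter (f · ≠ j)).card < n - k + 1 then 1 else 0 := by
    intro f
    have hcard : ∀ j, (Finset.univ.filter (f · ≠ j)).card < n - k + 1 ↔
        k ≤ (fiber (fun x => (f x : ℕ)) j).card := by
      intro j
      have h := Finset.card_filter_add_card_filter_not (s := Finset.univ) (f · = j)
      have h' : fiber (fun x => (f x : ℕ)) j = Finset.univ.filter (f · = j) := by
        ext x; simp [mem_fiber, Fin.ext_iff]
      rw [Finset.card_univ, Fintype.card_fin] at h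
      rw [h']
      simp only [ne_eq]
      omega
    simp_rw [hcard]
    split_ifs with hP
    · obtain ⟨i, hi⟩ := (completeIn_iff (by omega) f).1 hP
      obtain ⟨x, hx⟩ := Finset.card_pos.1 (show 0 < (fiber (fun x => (f x : ℕ)) i).card by omega)
      obtain rfl := (mem_fiber (F := fun x => (f x : ℕ))).1 hx
      rw [Finset.sum_eq_single (f x), if_pos hi]
      · intro j _ hj
        have := card_fiber_add_card_fiber_le (F := fun x => (f x : ℕ)) (Fin.val_ne_of_ne hj)
        rw [if_neg (by omega)]
      · simp
    · symm
      refine Finset.sum_eq_zero fun j _ => if_neg fun hj => hP ?_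
      exact (completeIn_iff (by omega) f).2 ⟨j, hj⟩
  rw [Finset.card_filter, Finset.sum_congr rfl fun f _ => hmono f, Finset.sum_comm]
  have hj : ∀ j : Fin c,
      (∑ f : Fin n → Fin c, if (Finset.univ.filter (f · ≠ j)).card < n - k + 1 then 1 else 0) =
      ∑ i ∈ Finset.range (n - k + 1), n.choose i * (c - 1) ^ i := by
    intro j
    have hT := Finset.sum_powerset_apply_card (x := (Finset.univ : Finset (Fin n)))
      (fun i => if i < n - k + 1 then (c - 1) ^ i else 0)
    rw [Finset.card_univ, Fintype.card_fin] at hT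
    rw [← Finset.sum_fiberwise_of_maps_to (g := fun f : Fin n → Fin c =>
      Finset.univ.filter (f · ≠ j)) (t := (Finset.univ : Finset (Fin n)).powerset)
      (fun _ _ => by simp)]
    refine (Finset.sum_congr rfl fun T _ => ?_).trans (hT.trans ?_)
    · rw [Finset.sum_congr rfl (g := fun _ => if T.card < n - k + 1 then 1 else 0) fun f hf => by
        rw [(Finset.mem_filter.1 hf).2], Finset.sum_const, card_filter_ne_eq]
      simp
    · simp only [smul_eq_mul, mul_ite, mul_zero]
      rw [← Finset.sum_filter]
      congr 1
      ext i
      simp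
      omega
  rw [Finset.sum_congr rfl fun j _ => hj j]
  simp

theorem card_proper_add_card_completeIn (hk : 0 < k) [DecidablePred (completeIn n k c)] :
    Nat.card {f : Fin n → Fin c //
      ∀ e : Finset (Fin n), e.card = k → ∃ x ∈ e, ∃ y ∈ e, f x ≠ f y} +
      (Finset.univ.filter fun f : Fin n → Fin c => completeIn n k c f).card = c ^ n := by
  have hiff : ∀ f : Fin n → Fin c,
      (∀ e : Finset (Fin n), e.card = k → ∃ x ∈ e, ∃ y ∈ e, f x ≠ f y) ↔
        ¬ completeIn n k c f := by
    intro f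
    constructor
    · rintro h ⟨e, he, i, hi⟩
      obtain ⟨x, hx, y, hy, hxy⟩ := h e he
      exact hxy ((hi x hx).trans (hi y hy).symm)
    · intro h e he
      by_contra! hmono
      obtain ⟨y, hy⟩ := Finset.card_pos.1 (he ▸ hk)
      exact h ⟨e, he, f y, fun x hx => hmono x hx y hy⟩
  rw [Nat.card_congr (Equiv.subtypeEquivRight hiff), Nat.card_eq_fintype_card,
    Fintype.card_subtype, add_comm, Finset.card_filter_add_card_filter_not]
  simp

end Counting

section ChromaticPolynomial

open Polynomial

/-- The polynomial `Σ_{i ≤ d} C(n, i) (X - 1) ^ i`. -/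
noncomputable def truncatedBinomial (n d : ℕ) : ℚ[X] :=
  ∑ i ∈ Finset.range (d + 1), C (n.choose i : ℚ) * (X - 1) ^ i

theorem truncatedBinomial_self (n : ℕ) : truncatedBinomial n n = X ^ n := by
  have h := add_pow (X - 1 : ℚ[X]) 1 n
  rw [sub_add_cancel] at h
  rw [h, truncatedBinomial]
  refine Finset.sum_congr rfl fun i _ => ?_
  simp [mul_comm]

theorem truncatedBinomial_succ_succ (n d : ℕ) : truncatedBinomial (n + 1) (d + 1) =
    truncatedBinomial n (d + 1) + (X - 1) * truncatedBinomial n d := by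
  simp only [truncatedBinomial]
  rw [Finset.sum_range_succ', Finset.sum_range_succ' _ (d + 1), Finset.mul_sum, add_right_comm,
    ← Finset.sum_add_distrib]
  congr 1
  · refine Finset.sum_congr rfl fun i _ => ?_
    rw [Nat.choose_succ_succ]
    simp only [Nat.cast_add, map_add]
    ring
  · simp

theorem coeff_truncatedBinomial_sign {n d : ℕ} (h : d ≤ n) (s : ℕ) :
    0 ≤ (-1) ^ (d + s) * (truncatedBinomial n d).coeff s := by
  induction n generalizing d s with
  | zero =>
    obtain rfl := Nat.le_zero.1 h
    rw [truncatedBinomial_self, coeff_X_pow]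
    split_ifs with hs <;> simp [hs]
  | succ n ih =>
    rcases h.eq_or_lt with rfl | h
    · rw [truncatedBinomial_self, coeff_X_pow]
      split_ifs with hs
      · rw [hs, Even.neg_one_pow ⟨n + 1, rfl⟩]
        norm_num
      · simp
    · cases d with
      | zero =>
        simp only [truncatedBinomial, zero_add, Finset.sum_range_one, Nat.choose_zero_right,
          Nat.cast_one, map_one, pow_zero, mul_one, coeff_one]
        split_ifs with hs <;> simp [hs]
      | succ d =>
        have h1 := ih (d := d + 1) (by omega) s
        have h2 := ih (d := d) (by omega) s
        rw [truncatedBinomial_succ_succ, sub_mul, one_mul, coeff_add, coeff_sub]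
        cases s with
        | zero =>
          rw [coeff_X_mul_zero]
          rw [pow_add, pow_succ] at *
          linarith
        | succ s =>
          have h3 := ih (d := d) (by omega) s
          rw [coeff_X_mul]
          rw [pow_add, pow_succ, pow_succ] at *
          linarith

theorem natDegree_truncatedBinomial_le (n d : ℕ) : (truncatedBinomial n d).natDegree ≤ d := by
  refine natDegree_sum_le_of_forall_le _ _ fun i hi => ?_
  have hi' : i ≤ d := by simpa [Nat.lt_succ_iff] using hi
  refine (natDegree_C_mul_le _ _).trans ((natDegree_pow_le).trans ?_)
  rw [← C_1, natDegree_X_sub_C, mul_one]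
  exact hi'

theorem sum_abs_coeff_truncatedBinomial {n d N : ℕ} (h : d ≤ n) (hN : d < N) :
    ∑ s ∈ Finset.range N, |(truncatedBinomial n d).coeff s| =
      (-1) ^ d * (truncatedBinomial n d).eval (-1) := by
  rw [eval_eq_sum_range' ((natDegree_truncatedBinomial_le n d).trans_lt hN), Finset.mul_sum]
  refine Finset.sum_congr rfl fun s _ => ?_
  have h1 := abs_of_nonneg (coeff_truncatedBinomial_sign h s)
  rw [abs_mul, abs_pow, abs_neg, abs_one, one_pow, one_mul] at h1
  rw [h1, pow_add]
  ring

theorem eq_of_eval_natCast_eq {p q : ℚ[X]}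
    (h : ∀ c : ℕ, 0 < c → p.eval (c : ℚ) = q.eval (c : ℚ)) : p = q := by
  refine eq_of_infinite_eval_eq p q (Set.infinite_of_injective_forall_mem
    (f := fun c : ℕ => ((c + 1 : ℕ) : ℚ)) (fun a b hab => ?_) fun c => h (c + 1) c.succ_pos)
  simpa using hab

theorem eval_truncatedBinomial_natCast {n d c : ℕ} (hc : 0 < c) :
    (truncatedBinomial n d).eval (c : ℚ) =
      ((∑ i ∈ Finset.range (d + 1), n.choose i * (c - 1) ^ i : ℕ) : ℚ) := by
  simp [truncatedBinomial, eval_finsetSum, Nat.cast_pred hc]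

theorem sum_neg_one_pow_mul_card_lamBas {n k : ℕ} (hk : 0 < k) (hn : n < 2 * k) (hkn : k ≤ n) :
    ∑ i ∈ Finset.range (n - k + 2), (-1) ^ i * (Fintype.card (LamBas n (completeIn n k) i) : ℚ) =
      -(truncatedBinomial n (n - k)).eval (-1) := by
  classical
  have hpoly : ∑ i ∈ Finset.range (n - k + 2),
      C ((Fintype.card (LamBas n (completeIn n k) i) : ℚ) / i.factorial) * descPochhammer ℚ i =
      X * truncatedBinomial n (n - k) := by
    refine eq_of_eval_natCast_eq fun c hc => ?_
    rw [eval_mul, eval_X, eval_truncatedBinomial_natCast hc, ← Nat.cast_mul,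
      ← card_completeIn_eq_sum_pow hn hkn, card_completeIn_eq_sum_choose hk, eval_finsetSum]
    push_cast
    refine Finset.sum_congr rfl fun i _ => ?_
    rw [eval_mul, eval_C, descPochhammer_eval_eq_descFactorial,
      Nat.descFactorial_eq_factorial_mul_choose]
    have := Nat.factorial_ne_zero i
    push_cast
    field_simp
  have heval := congrArg (Polynomial.eval (-1)) hpoly
  rw [eval_mul, eval_X, eval_finsetSum, neg_one_mul] at heval
  rw [← heval]
  refine Finset.sum_congr rfl fun i _ => ?_
  have h1 := ascPochhammer_eval_neg_eq_descPochhammer ℚ (-1 : ℚ) i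
  rw [neg_neg, ascPochhammer_eval_one] at h1
  have h2 : (descPochhammer ℚ i).eval (-1) = (-1) ^ i * (i.factorial : ℚ) := by
    rw [h1, ← mul_assoc, ← pow_add, Even.neg_one_pow ⟨i, rfl⟩, one_mul]
  have := Nat.factorial_ne_zero i
  rw [eval_mul, eval_C, h2]
  field_simp

theorem chromatic_eq {n k : ℕ} (hk : 0 < k) (hn : n < 2 * k) (hkn : k ≤ n) {chi : ℚ[X]}
    (hchi : ∀ c : ℕ, 0 < c → chi.eval (c : ℚ) =
      Nat.card {f : Fin n → Fin c //
        ∀ e : Finset (Fin n), e.card = k → ∃ x ∈ e, ∃ y ∈ e, f x ≠ f y}) :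
    chi = X ^ n - X * truncatedBinomial n (n - k) := by
  classical
  refine eq_of_eval_natCast_eq fun c hc => ?_
  rw [hchi c hc, eval_sub, eval_pow, eval_mul, eval_X, eval_truncatedBinomial_natCast hc,
    ← Nat.cast_mul, ← card_completeIn_eq_sum_pow hn hkn, eq_sub_iff_add_eq]
  exact_mod_cast card_proper_add_card_completeIn hk

theorem sum_abs_coeff_sub_X_mul {n d : ℕ} (h : d + 2 ≤ n) :
    ∑ j ∈ (X ^ n - X * truncatedBinomial n d).support,
      |(X ^ n - X * truncatedBinomial n d).coeff j| =
      1 + (-1) ^ d * (truncatedBinomial n d).eval (-1) := by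
  obtain ⟨N, rfl⟩ := Nat.exists_eq_add_one_of_ne_zero (n := n) (by omega)
  have hzero : ∀ s, d < s → (truncatedBinomial (N + 1) d).coeff s = 0 := fun s hs =>
    coeff_eq_zero_of_natDegree_lt ((natDegree_truncatedBinomial_le _ _).trans_lt hs)
  have hsub : (X ^ (N + 1) - X * truncatedBinomial (N + 1) d).support ⊆
      Finset.range (N + 2) := by
    intro j hj
    by_contra hj'
    rw [Finset.mem_range, not_lt] at hj'
    obtain ⟨j, rfl⟩ := Nat.exists_eq_add_one_of_ne_zero (n := j) (by omega)
    refine mem_support_iff.1 hj ?_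
    rw [coeff_sub, coeff_X_pow, if_neg (by omega), coeff_X_mul, hzero _ (by omega), sub_zero]
  rw [Finset.sum_subset hsub fun j _ hj => by rw [notMem_support_iff.1 hj, abs_zero],
    Finset.sum_range_succ, Finset.sum_range_succ',
    ← sum_abs_coeff_truncatedBinomial (n := N + 1) (N := N) (by omega) (by omega),
    add_comm (1 : ℚ)]
  congr 1
  · rw [coeff_sub, coeff_X_mul_zero, coeff_X_pow, if_neg (by omega), sub_zero, abs_zero, add_zero]
    refine Finset.sum_congr rfl fun s hs => ?_
    have := Finset.mem_range.1 hs
    rw [coeff_sub, coeff_X_mul, coeff_X_pow, if_neg (by omega), zero_sub, abs_neg]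
  · rw [coeff_sub, coeff_X_mul, coeff_X_pow, if_pos rfl, hzero _ (by omega), sub_zero, abs_one]

end ChromaticPolynomial

/-- Theorem (paper Cor. `Homology_Complete_Hypergraph`): for the complete `k`-uniform
hypergraph `H` on `n` vertices with `k ≥ 3`, `k > n/2` and `k ≤ n-1`, the reduced simplicial
homology of `Λ(H)` over `ℚ` vanishes except in dimension `n-k-1`, where its dimension equals
`(Σ_j |c_j|) - 1`, `χ_H(λ) = Σ_j c_j λ^j` being the chromatic polynomial of `H`.
Reduced homological degree `r` corresponds to partitions with `m + 1 = r + 2` blocks, so the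
degree `n-k-1` corresponds to `m = n-k`. -/
theorem homology_coloring_complex_complete (n k : ℕ) (hk : 3 ≤ k) (hhalf : n < 2 * k)
    (hkn : k ≤ n - 1) (chi : Polynomial ℚ)
    (hchi : ∀ c : ℕ, 0 < c → chi.eval (c : ℚ) =
      Nat.card {f : Fin n → Fin c //
        ∀ e : Finset (Fin n), e.card = k → ∃ x ∈ e, ∃ y ∈ e, f x ≠ f y}) :
    (∀ m : ℕ, m ≠ n - k →
      Module.finrank ℚ (homologyOf (lamBnd n (completeIn n k) (m + 1))
        (lamBnd n (completeIn n k) m)) = 0) ∧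
    (Module.finrank ℚ (homologyOf (lamBnd n (completeIn n k) (n - k + 1))
        (lamBnd n (completeIn n k) (n - k))) : ℚ)
      = (∑ j ∈ chi.support, |chi.coeff j|) - 1 := by
  refine ⟨fun m hm => finrank_homology_eq_zero (by omega) hhalf hm (by omega), ?_⟩
  rw [chromatic_eq (by omega) hhalf (by omega) hchi, sum_abs_coeff_sub_X_mul (by omega),
    finrank_homology_top (by omega) hhalf (by omega),
    sum_neg_one_pow_mul_card_lamBas (by omega) hhalf (by omega), pow_succ]
  ring
end

section
/- Let k ≥ 3, k > n/2, k ≤ n−1, and let H be the complete k-uniform hypergraph on {1,...,n}. Let Γ be the set of facets F of Λ(H) such that max(B_{h(F)}) > w_{h(F)} and the word w(F) = w_1 w_2 ... w_{n−k} satisfies w_1 > w_2 > ... > w_{h(F)−1} and w_{h(F)} > w_{h(F)+1} > ... > w_{n−k}. Then the cohomology classes [σ^F], for F ∈ Γ, form a basis of the reduced simplicial cohomology group H̃^{n−k−1}(Λ(H); ℤ). -/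
open Function

/-- Matrix of the simplicial coboundary map (over `ℤ`) of the coloring complex, the
transpose of the boundary map `δ(B_1, …, B_{r+2}) = Σ_i (-1)^i (B_1, …, B_i ∪ B_{i+1}, …)`. -/
def coLamMat (n : ℕ) (P : (m : ℕ) → (Fin n → Fin m) → Prop) (m : ℕ)
    (f : LamBas n P m) (g : LamBas n P (m + 1)) : ℤ :=
  ∑ j : Fin m, (-1 : ℤ) ^ ((j : ℕ) + 1) * (if mergeMap j ∘ g.1 = f.1 then 1 else 0)

/-- The coboundary map of the (reduced) cochain complex of `Λ(H)` over `ℤ`. -/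
noncomputable def coLamBnd (n : ℕ) (P : (m : ℕ) → (Fin n → Fin m) → Prop) (m : ℕ) :
    (LamBas n P m → ℤ) →ₗ[ℤ] (LamBas n P (m + 1) → ℤ) := matLin (coLamMat n P m)

/-- The condition describing the set `Γ` of homology facets: a facet of `Λ(H)` (for the
hypergraphs considered here) is an ordered set partition `F` of the vertices into
`n - k + 1` blocks, one block `B_{h(F)}` of size `k` and all others singletons; `w(F) =
w_1 ⋯ w_{n-k}` lists the singleton entries in order.  The condition states:
`max B_{h(F)} > w_{h(F)}` (vacuous if `h(F)` is the last index) and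
`w_1 > ⋯ > w_{h(F)-1}`, `w_{h(F)} > ⋯ > w_{n-k}`.  In the `0`-indexed encoding by a
surjection `f`, `hI` is the index of the size-`k` block, the singleton at position `p` is
the unique `x` with `f x = p`, and consecutive singleton positions on either side of `hI`
must be decreasing. -/
def gammaCond (n k : ℕ) (f : Fin n → Fin (n - k + 1)) : Prop :=
  ∃ hI : Fin (n - k + 1),
    (Finset.univ.filter fun x => f x = hI).card = k ∧
    (∀ p : Fin (n - k + 1), (p : ℕ) + 1 < (hI : ℕ) →
      ∀ x y : Fin n, f x = p → f y = p + 1 → y < x) ∧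
    (∀ p : Fin (n - k + 1), (hI : ℕ) < (p : ℕ) → (p : ℕ) + 1 < n - k + 1 →
      ∀ x y : Fin n, f x = p → f y = p + 1 → y < x) ∧
    ((hI : ℕ) + 1 < n - k + 1 →
      ∀ y : Fin n, f y = hI + 1 → ∃ x : Fin n, f x = hI ∧ y < x)


namespace ColoringComplex

open Finset

/-- `h` is the index of the unique block of size `k` of `f`; all other blocks are singletons. -/
structure IsBig {n m : ℕ} (k : ℕ) (f : Fin n → Fin m) (h : Fin m) : Prop where
  card : (univ.filter fun x => f x = h).card = k
  inj : ∀ x y, f x = f y → f x ≠ h → x = y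

theorem exists_isBig {n k d : ℕ} (hn : n = k + d) {f : Fin n → Fin (d + 1)}
    (hf : Function.Surjective f) (hP : completeIn n k (d + 1) f) : ∃ h, IsBig k f h := by
  obtain ⟨e, he, h, heh⟩ := hP
  have hsum : ∑ i : Fin (d + 1), (univ.filter fun x => f x = i).card = n := by
    have := card_eq_sum_card_fiberwise (s := (univ : Finset (Fin n)))
      (t := (univ : Finset (Fin (d + 1)))) (f := f) (by intro x _; simp)
    simpa using this.symm
  have hpos : ∀ i, 1 ≤ (univ.filter fun x => f x = i).card := by
    intro i
    obtain ⟨x, hx⟩ := hf i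
    exact card_pos.mpr ⟨x, by simp [hx]⟩
  have hke : k ≤ (univ.filter fun x => f x = h).card := by
    rw [← he]
    exact card_le_card fun x hx => by simp [heh x hx]
  rw [← add_sum_erase _ _ (mem_univ h)] at hsum
  have hrest : d ≤ ∑ i ∈ univ.erase h, (univ.filter fun x => f x = i).card := by
    have := card_nsmul_le_sum (univ.erase h) (fun i => (univ.filter fun x => f x = i).card) 1
      (fun i _ => hpos i)
    simpa [card_erase_of_mem] using this
  refine ⟨h, by omega, fun x y hxy hne => ?_⟩
  by_contra hxy'
  have h2 : 2 ≤ (univ.filter fun z => f z = f x).card := by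
    have := card_le_card (s := {x, y}) (t := univ.filter fun z => f z = f x)
      (by intro z hz; simp at hz; rcases hz with rfl | rfl <;> simp [hxy])
    rwa [card_pair hxy'] at this
  have hrest' : d < ∑ i ∈ univ.erase h, (univ.filter fun x => f x = i).card := by
    have := sum_lt_sum (s := univ.erase h) (f := fun _ => 1)
      (g := fun i => (univ.filter fun x => f x = i).card) (fun i _ => hpos i)
      ⟨f x, by simp [hne], h2⟩
    simpa [card_erase_of_mem] using this
  omega

theorem eq_of_two_le_card {n m k : ℕ} {f : Fin n → Fin m} {h i : Fin m} (hb : IsBig k f h)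
    (hi : 2 ≤ (univ.filter fun x => f x = i).card) : i = h := by
  obtain ⟨x, hx, y, hy, hxy⟩ := one_lt_card.mp hi
  simp only [mem_filter, mem_univ, true_and] at hx hy
  by_contra hne
  exact hxy (hb.inj x y (hx.trans hy.symm) (by rwa [hx]))

theorem IsBig.unique {n m k : ℕ} (hk : 2 ≤ k) {f : Fin n → Fin m} {h h' : Fin m}
    (hb : IsBig k f h) (hb' : IsBig k f h') : h' = h :=
  eq_of_two_le_card hb (by rw [hb'.card]; exact hk)

theorem IsBig.completeIn {n m k : ℕ} {f : Fin n → Fin m} {h : Fin m} (hb : IsBig k f h) :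
    completeIn n k m f :=
  ⟨_, hb.card, h, fun x hx => by simpa using hx⟩

theorem IsBig.comp_perm {n m k : ℕ} {f : Fin n → Fin m} {h : Fin m} (hb : IsBig k f h)
    (σ : Equiv.Perm (Fin n)) : IsBig k (f ∘ σ) h := by
  refine ⟨?_, fun x y hxy hne => σ.injective (hb.inj _ _ hxy hne)⟩
  rw [← hb.card]
  refine card_bij (fun x _ => σ x) (by simp) (fun x _ y _ hxy => σ.injective hxy) fun y hy => ?_
  exact ⟨σ.symm y, by simpa using hy, by simp⟩

theorem val_mergeMap {m : ℕ} (j : Fin m) (x : Fin (m + 1)) :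
    (mergeMap j x : ℕ) = if (x : ℕ) ≤ j then (x : ℕ) else (x : ℕ) - 1 := by
  unfold mergeMap
  split_ifs <;> rfl

theorem mergeMap_surjective {m : ℕ} (j : Fin m) : Function.Surjective (mergeMap j) := by
  intro i
  by_cases h : (i : ℕ) ≤ j
  · exact ⟨i.castSucc, Fin.ext (by simp [val_mergeMap, h])⟩
  · refine ⟨i.succ, Fin.ext ?_⟩
    rw [val_mergeMap, if_neg (by simp; omega)]
    simp

theorem mergeMap_eq_self {m : ℕ} (j : Fin m) (x : Fin (m + 1)) :
    mergeMap j x = j ↔ (x : ℕ) = j ∨ (x : ℕ) = j + 1 := by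
  rw [Fin.ext_iff, val_mergeMap]
  split_ifs <;> omega

theorem eq_or_of_mergeMap_eq {m : ℕ} {j : Fin m} {x y : Fin (m + 1)}
    (h : mergeMap j x = mergeMap j y) :
    (x : ℕ) = y ∨ (((x : ℕ) = j ∨ (x : ℕ) = j + 1) ∧ ((y : ℕ) = j ∨ (y : ℕ) = j + 1)) := by
  rw [Fin.ext_iff, val_mergeMap, val_mergeMap] at h
  split_ifs at h <;> omega

/-- The fibre of a merged facet over an unmerged index containing at least two points is the
big block. -/
theorem merge_fibre {n d k : ℕ} {f : Fin n → Fin (d + 1)} {h : Fin (d + 1)} (hb : IsBig k f h)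
    {j i : Fin d} (hij : i ≠ j) {x y : Fin n} (hxy : x ≠ y) (hx : mergeMap j (f x) = i)
    (hy : mergeMap j (f y) = i) :
    (univ.filter fun z => mergeMap j (f z) = i).card = k := by
  have key : ∀ z w, mergeMap j (f z) = i → mergeMap j (f w) = i → f z = f w := by
    intro z w hz hw
    have := eq_or_of_mergeMap_eq (hz.trans hw.symm)
    rcases this with h1 | ⟨h1, -⟩
    · exact Fin.ext h1
    · exact absurd (hz.symm.trans ((mergeMap_eq_self j _).2 h1)) hij
  have hfx : f x = h := by
    by_contra hne
    exact hxy (hb.inj x y (key x y hx hy) hne)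
  rw [← hb.card]
  congr 1
  ext z
  simp only [mem_filter, mem_univ, true_and]
  constructor
  · intro hz
    rw [key z x hz hx, hfx]
  · intro hz
    rw [hz, ← hfx, hx]

theorem merge_index_unique {n k d : ℕ} (hd : n < 2 * k) {f f' : Fin n → Fin (d + 1)}
    {h h' : Fin (d + 1)} (hf : Function.Surjective f) (hf' : Function.Surjective f')
    (hb : IsBig k f h) (hb' : IsBig k f' h') {j j' : Fin d}
    (hm : mergeMap j ∘ f = mergeMap j' ∘ f') : j = j' := by
  have hm' : ∀ x, mergeMap j (f x) = mergeMap j' (f' x) := fun x => congrFun hm x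
  by_contra hne
  obtain ⟨x, hx⟩ := hf j.castSucc
  obtain ⟨y, hy⟩ := hf j.succ
  obtain ⟨x', hx'⟩ := hf' j'.castSucc
  obtain ⟨y', hy'⟩ := hf' j'.succ
  have hxy : x ≠ y := by
    rintro rfl
    rw [hx, Fin.ext_iff] at hy
    simp at hy
  have hxy' : x' ≠ y' := by
    rintro rfl
    rw [hx', Fin.ext_iff] at hy'
    simp at hy'
  have h1 := merge_fibre hb (Ne.symm hne) hxy' (i := j')
    (by rw [hm', mergeMap_eq_self, hx']; simp) (by rw [hm', mergeMap_eq_self, hy']; simp)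
  have h2 := merge_fibre hb' hne hxy (i := j)
    (by rw [← hm', mergeMap_eq_self, hx]; simp) (by rw [← hm', mergeMap_eq_self, hy]; simp)
  simp only [hm'] at h1
  have hdisj : Disjoint (univ.filter fun z => mergeMap j' (f' z) = j')
      (univ.filter fun z => mergeMap j' (f' z) = j) := by
    rw [disjoint_filter]
    intro z _ hz hz'
    exact hne (hz'.symm.trans hz)
  have := card_le_univ ((univ.filter fun z => mergeMap j' (f' z) = j') ∪
      (univ.filter fun z => mergeMap j' (f' z) = j))
  rw [card_union_of_disjoint hdisj, h1, h2, Fintype.card_fin] at this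
  omega

/-- The facet `f` with the blocks `j` and `j + 1` merged, as a face of the coloring complex. -/
def mergeFace {n k d : ℕ} (f : LamBas n (completeIn n k) (d + 1)) (j : Fin d) :
    LamBas n (completeIn n k) d :=
  ⟨mergeMap j ∘ f.1, (mergeMap_surjective j).comp f.2.1, by
    obtain ⟨e, he, i, hi⟩ := f.2.2
    exact ⟨e, he, mergeMap j i, fun x hx => by simp [hi x hx]⟩⟩

theorem coLamBnd_single {n k d : ℕ} (g : LamBas n (completeIn n k) d)
    (f : LamBas n (completeIn n k) (d + 1)) :
    coLamBnd n (completeIn n k) d (Pi.single g 1) f = coLamMat n (completeIn n k) d g f := by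
  simp [coLamBnd, matLin, Pi.single_apply]

theorem coLamMat_eq {n k d : ℕ} (hn : n = k + d) (hd : n < 2 * k)
    {g : LamBas n (completeIn n k) d}
    {f : LamBas n (completeIn n k) (d + 1)} {j : Fin d} (hj : mergeMap j ∘ f.1 = g.1) :
    coLamMat n (completeIn n k) d g f = (-1) ^ ((j : ℕ) + 1) := by
  obtain ⟨h, hb⟩ := exists_isBig hn f.2.1 f.2.2
  unfold coLamMat
  rw [sum_eq_single j]
  · simp [hj]
  · intro i _ hi
    rw [if_neg, mul_zero]
    intro hi'
    exact hi (merge_index_unique hd f.2.1 f.2.1 hb hb (hi'.trans hj.symm))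
  · simp

theorem coLamMat_eq_zero {n k d : ℕ} {g : LamBas n (completeIn n k) d}
    {f : LamBas n (completeIn n k) (d + 1)} (hj : ∀ j, mergeMap j ∘ f.1 ≠ g.1) :
    coLamMat n (completeIn n k) d g f = 0 := by
  unfold coLamMat
  exact sum_eq_zero fun j _ => by rw [if_neg (hj j), mul_zero]

/-- A facet lies in a submodule containing all coboundaries as soon as all other facets with the
same ridge do. -/
theorem single_mem_of_merge {n k d : ℕ} (hn : n = k + d) (hd : n < 2 * k)
    {N : Submodule ℤ (LamBas n (completeIn n k) (d + 1) → ℤ)}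
    (hN : LinearMap.range (coLamBnd n (completeIn n k) d) ≤ N)
    (f : LamBas n (completeIn n k) (d + 1)) (j : Fin d)
    (hf : ∀ f' : LamBas n (completeIn n k) (d + 1), f' ≠ f →
      mergeMap j ∘ f'.1 = mergeMap j ∘ f.1 → Pi.single f' (1 : ℤ) ∈ N) :
    Pi.single f (1 : ℤ) ∈ N := by
  set g := mergeFace f j with hg
  have h1 : coLamBnd n (completeIn n k) d (Pi.single g 1) ∈ N := hN ⟨_, rfl⟩
  have h2 : coLamBnd n (completeIn n k) d (Pi.single g 1) =
      ∑ f', coLamMat n (completeIn n k) d g f' • Pi.single f' (1 : ℤ) := by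
    funext f'
    rw [coLamBnd_single]
    simp [Finset.sum_apply, Pi.single_apply]
  rw [h2, ← add_sum_erase _ _ (mem_univ f)] at h1
  have h3 : ∑ f' ∈ univ.erase f, coLamMat n (completeIn n k) d g f' • Pi.single f' (1 : ℤ) ∈ N := by
    refine N.sum_mem fun f' hf' => ?_
    by_cases hj : ∃ i, mergeMap i ∘ f'.1 = g.1
    · obtain ⟨i, hi⟩ := hj
      obtain ⟨h, hb⟩ := exists_isBig hn f.2.1 f.2.2
      obtain ⟨h', hb'⟩ := exists_isBig hn f'.2.1 f'.2.2
      have : i = j := merge_index_unique hd f'.2.1 f.2.1 hb' hb hi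
      subst this
      exact N.smul_mem _ (hf f' (ne_of_mem_erase hf') hi)
    · push Not at hj
      rw [coLamMat_eq_zero hj, zero_smul]
      exact N.zero_mem
  have h4 := (N.add_mem_iff_left h3).1 h1
  rw [coLamMat_eq hn hd (g := g) (f := f) (j := j) rfl] at h4
  rcases neg_one_pow_eq_or ℤ ((j : ℕ) + 1) with h5 | h5
  · simpa [h5] using h4
  · simpa [h5] using h4

/-- The facet `f` with the elements `a` and `b` exchanged. -/
def swapFace {n k d : ℕ} (hn : n = k + d) (f : LamBas n (completeIn n k) (d + 1)) (a b : Fin n) :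
    LamBas n (completeIn n k) (d + 1) :=
  ⟨f.1 ∘ Equiv.swap a b, f.2.1.comp (Equiv.surjective _), by
    obtain ⟨h, hb⟩ := exists_isBig hn f.2.1 f.2.2
    exact (hb.comp_perm _).completeIn⟩

theorem single_mem_of_swap {n k d : ℕ} (hn : n = k + d) (hd : n < 2 * k)
    {N : Submodule ℤ (LamBas n (completeIn n k) (d + 1) → ℤ)}
    (hN : LinearMap.range (coLamBnd n (completeIn n k) d) ≤ N)
    (f : LamBas n (completeIn n k) (d + 1)) {h : Fin (d + 1)} (hb : IsBig k f.1 h)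
    {a b : Fin n} (hab : (f.1 b : ℕ) = f.1 a + 1) (ha : f.1 a ≠ h) (hbh : f.1 b ≠ h)
    (hs : Pi.single (swapFace hn f a b) (1 : ℤ) ∈ N) : Pi.single f (1 : ℤ) ∈ N := by
  have hne : a ≠ b := by rintro rfl; omega
  refine single_mem_of_merge hn hd hN f ⟨f.1 a, by have := (f.1 b).2; omega⟩ fun f' hf' hm => ?_
  have hm' := fun x => eq_or_of_mergeMap_eq (congrFun hm x)
  simp only at hm'
  have hoff : ∀ x, x ≠ a → x ≠ b → f'.1 x = f.1 x := by
    intro x hxa hxb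
    have h1 : (f.1 x : ℕ) ≠ f.1 a := fun h1 => hxa (hb.inj a x (Fin.ext h1.symm) ha).symm
    have h2 : (f.1 x : ℕ) ≠ f.1 b := fun h1 => hxb (hb.inj b x (Fin.ext h1.symm) hbh).symm
    have := hm' x
    apply Fin.ext
    omega
  have hoff' : ∀ x, x ≠ a → x ≠ b → (f'.1 x : ℕ) ≠ f.1 a ∧ (f'.1 x : ℕ) ≠ f.1 b := by
    intro x hxa hxb
    rw [hoff x hxa hxb]
    exact ⟨fun h1 => hxa (hb.inj a x (Fin.ext h1.symm) ha).symm,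
      fun h1 => hxb (hb.inj b x (Fin.ext h1.symm) hbh).symm⟩
  have hma := hm' a
  have hmb := hm' b
  obtain ⟨x, hx⟩ := f'.2.1 (f.1 a)
  obtain ⟨y, hy⟩ := f'.2.1 (f.1 b)
  have hx' : x = a ∨ x = b := by
    by_contra hc
    push Not at hc
    exact (hoff' x hc.1 hc.2).1 (by rw [hx])
  have hy' : y = a ∨ y = b := by
    by_contra hc
    push Not at hc
    exact (hoff' y hc.1 hc.2).2 (by rw [hy])
  have hcase : (f'.1 a = f.1 a ∧ f'.1 b = f.1 b) ∨ (f'.1 a = f.1 b ∧ f'.1 b = f.1 a) := by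
    rcases hx' with rfl | rfl <;> rcases hy' with rfl | rfl
    · rw [hx] at hy; rw [← hy] at hab; omega
    · exact Or.inl ⟨hx, hy⟩
    · exact Or.inr ⟨hy, hx⟩
    · rw [hx] at hy; rw [← hy] at hab; omega
  rcases hcase with ⟨h1, h2⟩ | ⟨h1, h2⟩
  · refine absurd (Subtype.ext (funext fun x => ?_)) hf'
    by_cases hxa : x = a
    · rw [hxa, h1]
    by_cases hxb : x = b
    · rw [hxb, h2]
    exact hoff x hxa hxb
  · have : f' = swapFace hn f a b := by
      refine Subtype.ext (funext fun x => ?_)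
      simp only [swapFace, Function.comp]
      by_cases hxa : x = a
      · rw [hxa, h1, Equiv.swap_apply_left]
      by_cases hxb : x = b
      · rw [hxb, h2, Equiv.swap_apply_right]
      rw [Equiv.swap_apply_of_ne_of_ne hxa hxb]
      exact hoff x hxa hxb
    rwa [this]

/-- Homology facets, with block positions compared as natural numbers. -/
structure IsGamma {n m : ℕ} (k : ℕ) (f : Fin n → Fin m) (h : Fin m) : Prop where
  big : IsBig k f h
  desc : ∀ a b, (f b : ℕ) = f a + 1 → f a ≠ h → f b ≠ h → b < a
  max : ∀ y, (f y : ℕ) = h + 1 → ∃ x, f x = h ∧ y < x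

theorem IsGamma.lt {n m k : ℕ} {f : Fin n → Fin m} {h : Fin m} (hg : IsGamma k f h)
    (hf : Function.Surjective f) {a b : Fin n} (hab : f a < f b) (hs : f b < h ∨ h < f a) :
    b < a := by
  obtain ⟨t, ht⟩ : ∃ t, (f b : ℕ) = f a + t + 1 := ⟨f b - f a - 1, by omega⟩
  induction t generalizing b with
  | zero => exact hg.desc a b (by omega) (by omega) (by omega)
  | succ t ih =>
    obtain ⟨c, hc⟩ := hf ⟨f a + t + 1, by omega⟩
    have hc' : (f c : ℕ) = f a + t + 1 := by rw [hc]
    have h1 : c < a := ih (by omega) (by omega) hc'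
    exact (hg.desc c b (by omega) (by omega) (by omega)).trans h1

theorem IsGamma.exists_lt {n m k : ℕ} {f : Fin n → Fin m} {h : Fin m} (hg : IsGamma k f h)
    (hf : Function.Surjective f) {y : Fin n} (hy : h < f y) : ∃ x, f x = h ∧ y < x := by
  obtain ⟨z, hz⟩ := hf ⟨h + 1, by omega⟩
  have hz' : (f z : ℕ) = h + 1 := by rw [hz]
  obtain ⟨x, hx, hzx⟩ := hg.max z hz'
  refine ⟨x, hx, ?_⟩
  rcases eq_or_ne (f z) (f y) with h1 | h1
  · rwa [← hg.big.inj z y h1 (by omega)]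
  · exact (hg.lt hf (a := z) (b := y) (by omega) (by omega)).trans hzx

theorem sum_swap_lt {n m : ℕ} (f : Fin n → Fin m) {a b : Fin n} (hab : a < b)
    (hf : (f b : ℕ) = f a + 1) :
    ∑ x : Fin n, (x : ℕ) * (f (Equiv.swap a b x) : ℕ) < ∑ x : Fin n, (x : ℕ) * (f x : ℕ) := by
  have hb : b ∈ (univ : Finset (Fin n)).erase a := by simp [hab.ne']
  rw [← add_sum_erase _ _ (mem_univ a), ← add_sum_erase _ _ hb,
    ← add_sum_erase univ (fun x : Fin n => (x : ℕ) * (f x : ℕ)) (mem_univ a),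
    ← add_sum_erase (univ.erase a) (fun x : Fin n => (x : ℕ) * (f x : ℕ)) hb]
  have hrest : ∑ x ∈ (univ.erase a).erase b, (x : ℕ) * (f (Equiv.swap a b x) : ℕ) =
      ∑ x ∈ (univ.erase a).erase b, (x : ℕ) * (f x : ℕ) := by
    refine sum_congr rfl fun x hx => ?_
    simp only [mem_erase, mem_univ, and_true] at hx
    rw [Equiv.swap_apply_of_ne_of_ne hx.2 hx.1]
  rw [hrest, Equiv.swap_apply_left, Equiv.swap_apply_right, hf]
  have : (a : ℕ) < b := hab
  nlinarith

theorem single_mem_of_good {n k d : ℕ} (hn : n = k + d) (hd : n < 2 * k)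
    {N : Submodule ℤ (LamBas n (completeIn n k) (d + 1) → ℤ)}
    (hN : LinearMap.range (coLamBnd n (completeIn n k) d) ≤ N)
    (hΓ : ∀ (f : LamBas n (completeIn n k) (d + 1)) (h : Fin (d + 1)),
      IsGamma k f.1 h → Pi.single f (1 : ℤ) ∈ N)
    (f : LamBas n (completeIn n k) (d + 1)) {h : Fin (d + 1)}
    (hb : IsBig k f.1 h) (hgood : ∀ y, h < f.1 y → ∃ x, f.1 x = h ∧ y < x) :
    Pi.single f (1 : ℤ) ∈ N := by
  induction hμ : ∑ x : Fin n, (x : ℕ) * (f.1 x : ℕ) using Nat.strong_induction_on generalizing f with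
  | _ μ ih =>
    subst hμ
    by_cases hasc : ∃ a b, (f.1 b : ℕ) = f.1 a + 1 ∧ f.1 a ≠ h ∧ f.1 b ≠ h ∧ a < b
    · obtain ⟨a, b, hab, ha, hb', hlt⟩ := hasc
      refine single_mem_of_swap hn hd hN f hb hab ha hb' ?_
      have hfix : ∀ x, f.1 x = h → Equiv.swap a b x = x := fun x hx =>
        Equiv.swap_apply_of_ne_of_ne (by rintro rfl; exact ha hx) (by rintro rfl; exact hb' hx)
      refine ih _ (sum_swap_lt f.1 hlt hab) (swapFace hn f a b) (hb.comp_perm _) ?_ rfl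
      intro y hy
      simp only [swapFace, Function.comp] at hy ⊢
      by_cases hya : y = a
      · obtain ⟨x, hx, hyx⟩ := hgood y (by
          rw [hya, Equiv.swap_apply_left] at hy
          rw [hya]
          omega)
        exact ⟨x, by rw [hfix x hx, hx], hyx⟩
      by_cases hyb : y = b
      · obtain ⟨x, hx, hyx⟩ := hgood y (by
          rw [hyb, Equiv.swap_apply_right] at hy
          rw [hyb]
          omega)
        exact ⟨x, by rw [hfix x hx, hx], hyx⟩
      rw [Equiv.swap_apply_of_ne_of_ne hya hyb] at hy
      obtain ⟨x, hx, hyx⟩ := hgood y hy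
      exact ⟨x, by rw [hfix x hx, hx], hyx⟩
    · push Not at hasc
      refine hΓ f h ⟨hb, fun a b hab ha hb' => ?_, fun y hy => hgood y (by omega)⟩
      refine lt_of_le_of_ne (hasc a b hab ha hb') ?_
      rintro rfl
      omega

theorem single_mem_of_bad {n k d : ℕ} (hn : n = k + d) (hk : 2 ≤ k) (hd : n < 2 * k)
    {N : Submodule ℤ (LamBas n (completeIn n k) (d + 1) → ℤ)}
    (hN : LinearMap.range (coLamBnd n (completeIn n k) d) ≤ N)
    (hΓ : ∀ (f : LamBas n (completeIn n k) (d + 1)) (h : Fin (d + 1)),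
      IsGamma k f.1 h → Pi.single f (1 : ℤ) ∈ N)
    (f : LamBas n (completeIn n k) (d + 1)) {h : Fin (d + 1)}
    (hb : IsBig k f.1 h)
    (hnext : ∀ (f' : LamBas n (completeIn n k) (d + 1)) (h' : Fin (d + 1)), IsBig k f'.1 h' →
      h < h' → Pi.single f' (1 : ℤ) ∈ N)
    {b : Fin n} (hbh : h < f.1 b) (hmax : ∀ x, h ≤ f.1 x → x ≤ b) :
    Pi.single f (1 : ℤ) ∈ N := by
  obtain ⟨s, hs⟩ : ∃ s, (f.1 b : ℕ) = h + s + 1 := ⟨f.1 b - h - 1, by omega⟩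
  induction s generalizing f b with
  | zero =>
    refine single_mem_of_merge hn hd hN f ⟨h, by omega⟩ fun f' hf' hm => ?_
    have hm' := fun x => eq_or_of_mergeMap_eq (congrFun hm x)
    simp only at hm'
    obtain ⟨h', hb'⟩ := exists_isBig hn f'.2.1 f'.2.2
    rcases lt_or_ge h h' with hlt | hge
    · exact hnext f' h' hb' hlt
    have hpair : ∀ x, f.1 x ≠ h → x ≠ b → f'.1 x = f.1 x := by
      intro x hx hxb
      have h1 : (f.1 x : ℕ) ≠ f.1 b := fun h1 => hxb (hb.inj b x (Fin.ext h1.symm) (by omega)).symm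
      have := hm' x
      apply Fin.ext
      omega
    have hh : h' = h := by
      by_contra hne
      obtain ⟨x, hx, y, hy, hxy⟩ := one_lt_card.mp (show 1 < _ from hb'.card ▸ hk)
      simp only [mem_filter, mem_univ, true_and] at hx hy
      have h1 := hm' x
      have h2 := hm' y
      refine hxy (hb.inj x y (Fin.ext ?_) ?_) <;> omega
    subst hh
    have hfb : f'.1 b = h' := by
      by_contra hfb
      have h1 : (f'.1 b : ℕ) = h' + 1 := by have := hm' b; omega
      refine hf' (Subtype.ext (funext fun x => ?_))
      by_cases hxb : x = b
      · rw [hxb]; apply Fin.ext; omega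
      by_cases hx : f.1 x = h'
      · have h2 := hm' x
        have h3 : (f'.1 x : ℕ) ≠ h' + 1 := fun h3 =>
          hxb (hb'.inj x b (Fin.ext (by omega)) (by omega))
        apply Fin.ext
        omega
      · exact hpair x hx hxb
    refine single_mem_of_good hn hd hN hΓ f' hb' fun y hy => ⟨b, hfb, ?_⟩
    have hyb : y ≠ b := by rintro rfl; omega
    refine lt_of_le_of_ne (hmax y ?_) hyb
    have := hm' y
    omega
  | succ s ih =>
    obtain ⟨a, ha⟩ := f.2.1 ⟨h + s + 1, by omega⟩
    have ha' : (f.1 a : ℕ) = h + s + 1 := by rw [ha]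
    refine single_mem_of_swap hn hd hN f hb (a := a) (b := b) (by omega) (by omega) (by omega) ?_
    refine ih (swapFace hn f a b) (hb.comp_perm _) (b := b) ?_ ?_ ?_
    · simp only [swapFace, Function.comp, Equiv.swap_apply_right]
      omega
    · intro x hx
      simp only [swapFace, Function.comp] at hx
      by_cases hxa : x = a
      · exact hmax x (by rw [hxa]; omega)
      by_cases hxb : x = b
      · rw [hxb]
      rw [Equiv.swap_apply_of_ne_of_ne hxa hxb] at hx
      exact hmax x hx
    · simp only [swapFace, Function.comp, Equiv.swap_apply_right]
      exact ha'

theorem single_mem {n k d : ℕ} (hn : n = k + d) (hk : 2 ≤ k) (hd : n < 2 * k)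
    {N : Submodule ℤ (LamBas n (completeIn n k) (d + 1) → ℤ)}
    (hN : LinearMap.range (coLamBnd n (completeIn n k) d) ≤ N)
    (hΓ : ∀ (f : LamBas n (completeIn n k) (d + 1)) (h : Fin (d + 1)),
      IsGamma k f.1 h → Pi.single f (1 : ℤ) ∈ N)
    (f : LamBas n (completeIn n k) (d + 1)) : Pi.single f (1 : ℤ) ∈ N := by
  obtain ⟨h, hb⟩ := exists_isBig hn f.2.1 f.2.2
  obtain ⟨t, ht⟩ : ∃ t, d ≤ h + t := ⟨d, by omega⟩
  induction t generalizing f h with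
  | zero =>
    exact single_mem_of_good hn hd hN hΓ f hb fun y hy => by have := (f.1 y).2; omega
  | succ t ih =>
    by_cases hgood : ∀ y, h < f.1 y → ∃ x, f.1 x = h ∧ y < x
    · exact single_mem_of_good hn hd hN hΓ f hb hgood
    push Not at hgood
    obtain ⟨y, hy, hyx⟩ := hgood
    obtain ⟨b, hbm, hbmax⟩ := exists_max_image (univ.filter fun x => h < f.1 x) id
      ⟨y, by simpa using hy⟩
    simp only [mem_filter, mem_univ, true_and, id] at hbm hbmax
    refine single_mem_of_bad hn hk hd hN hΓ f hb
      (fun f' h' hb' hlt => ih f' h' hb' (by omega)) hbm fun x hx => ?_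
    rcases hx.eq_or_lt with h1 | h1
    · exact (hyx x h1.symm).trans (hbmax y hy)
    · exact hbmax x h1

theorem gammaCond_iff {n k : ℕ} (hk : 2 ≤ k) {f : Fin n → Fin (n - k + 1)}
    (hb : ∃ h, IsBig k f h) :
    gammaCond n k f ↔ ∃ h, IsGamma k f h := by
  have hsucc : ∀ p : Fin (n - k + 1), (p : ℕ) + 1 < n - k + 1 →
      ((p + 1 : Fin (n - k + 1)) : ℕ) = p + 1 := by
    intro p hp
    rw [Fin.val_add, Fin.val_one', Nat.add_mod_mod, Nat.mod_eq_of_lt hp]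
  constructor
  · rintro ⟨h, hcard, hleft, hright, hmax⟩
    obtain ⟨h0, hb0⟩ := hb
    obtain rfl : h = h0 := eq_of_two_le_card hb0 (hk.trans_eq hcard.symm)
    refine ⟨h, hb0, fun a b hab ha hbh => ?_, fun y hy => ?_⟩
    · have hs : f b = f a + 1 := Fin.ext (by rw [hsucc _ (by omega), hab])
      rcases lt_or_gt_of_ne ha with hlt | hgt
      · exact hleft (f a) (by omega) a b rfl hs
      · exact hright (f a) hgt (by omega) a b rfl hs
    · have hh : (h : ℕ) + 1 < n - k + 1 := by omega
      exact hmax hh y (Fin.ext (by rw [hsucc _ hh, hy]))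
  · rintro ⟨h, hg⟩
    refine ⟨h, hg.big.card, fun p hp x y hx hy => ?_, fun p hp hp' x y hx hy => ?_,
      fun hh y hy => ?_⟩
    · have hy' : (f y : ℕ) = p + 1 := by rw [hy, hsucc _ (by omega)]
      subst hx
      exact hg.desc x y hy' (by omega) (by omega)
    · have hy' : (f y : ℕ) = p + 1 := by rw [hy, hsucc _ hp']
      subst hx
      exact hg.desc x y hy' (by omega) (by omega)
    · exact hg.max y (by rw [hy, hsucc _ hh])

/-- The sign of a self-map of `Fin m`, which vanishes unless the map is bijective. -/
def mapSign {m : ℕ} (π : Fin m → Fin m) : ℤ :=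
  ((1 : Matrix (Fin m) (Fin m) ℤ).submatrix π id).det

theorem mapSign_id {m : ℕ} : mapSign (id : Fin m → Fin m) = 1 := by
  simp [mapSign]

theorem mapSign_comp_swap {m : ℕ} (π : Fin m → Fin m) {a b : Fin m} (hab : a ≠ b) :
    mapSign (π ∘ Equiv.swap a b) = -mapSign π := by
  have := Matrix.det_permute (Equiv.swap a b) ((1 : Matrix (Fin m) (Fin m) ℤ).submatrix π id)
  rw [Matrix.submatrix_submatrix, Equiv.Perm.sign_swap hab] at this
  simpa [mapSign] using this

theorem injective_of_mapSign_ne_zero {m : ℕ} {π : Fin m → Fin m} (hπ : mapSign π ≠ 0) :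
    Function.Injective π := by
  intro a b hab
  by_contra hne
  exact hπ (Matrix.det_zero_of_row_eq hne (by
    funext i
    rw [Matrix.submatrix_apply, Matrix.submatrix_apply, hab]))

/-- The singletons of `f` (with big block `h`) among the `τ i` lie to the left of the big block
only if `i < c`, and to the right only if `c ≤ i`. -/
def Compat {n d : ℕ} (τ : Fin (d + 1) → Fin n) (c : ℕ) (f : Fin n → Fin (d + 1))
    (h : Fin (d + 1)) : Prop :=
  ∀ i, (f (τ i) < h → (i : ℕ) < c) ∧ (h < f (τ i) → c ≤ i)

open Classical in
/-- A cycle of the coloring complex, as a function on facets. -/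
noncomputable def cycle {n k d : ℕ} (τ : Fin (d + 1) → Fin n) (c : ℕ)
    (f : LamBas n (completeIn n k) (d + 1)) : ℤ :=
  ∑ h : Fin (d + 1),
    if IsBig k f.1 h ∧ Compat τ c f.1 h then (-1) ^ (h : ℕ) * mapSign (f.1 ∘ τ) else 0

open Classical in
theorem cycle_eq {n k d : ℕ} (hk : 2 ≤ k) (τ : Fin (d + 1) → Fin n) (c : ℕ)
    (f : LamBas n (completeIn n k) (d + 1)) {h : Fin (d + 1)} (hb : IsBig k f.1 h) :
    cycle τ c f = if Compat τ c f.1 h then (-1) ^ (h : ℕ) * mapSign (f.1 ∘ τ) else 0 := by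
  unfold cycle
  rw [sum_eq_single h]
  · simp [hb]
  · intro h' _ hne
    rw [if_neg]
    exact fun hc => hne (hb.unique hk hc.1)
  · simp

theorem compat_of_cycle_ne_zero {n k d : ℕ} (hk : 2 ≤ k) {τ : Fin (d + 1) → Fin n} {c : ℕ}
    {f : LamBas n (completeIn n k) (d + 1)} {h : Fin (d + 1)} (hb : IsBig k f.1 h)
    (hf : cycle τ c f ≠ 0) : Compat τ c f.1 h ∧ Function.Injective (f.1 ∘ τ) := by
  rw [cycle_eq hk τ c f hb] at hf
  split_ifs at hf with hc
  · exact ⟨hc, injective_of_mapSign_ne_zero (right_ne_zero_of_mul hf)⟩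
  · exact absurd rfl hf

/-- Exchange the blocks of `u` and `w`, except that `u` and `w` keep their position. -/
def toggle {n m : ℕ} (u w : Fin n) (f : Fin n → Fin m) : Fin n → Fin m := fun x =>
  if x = u ∨ x = w then f x else Equiv.swap (f u) (f w) (f x)

theorem toggle_comm {n m : ℕ} (u w : Fin n) (f : Fin n → Fin m) :
    toggle u w f = toggle w u f := by
  funext x
  simp only [toggle, or_comm, Equiv.swap_comm]

theorem toggle_toggle {n m : ℕ} (u w : Fin n) (f : Fin n → Fin m) :
    toggle u w (toggle u w f) = f := by
  funext x
  by_cases h : x = u ∨ x = w <;> simp [toggle, h]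

theorem toggle_comp {n m d : ℕ} {f : Fin n → Fin m} {τ : Fin (d + 1) → Fin n}
    (hinj : Function.Injective (f ∘ τ)) (p q : Fin (d + 1)) :
    toggle (τ p) (τ q) f ∘ τ = f ∘ τ := by
  funext i
  simp only [toggle, Function.comp]
  split_ifs with h
  · rfl
  · push Not at h
    refine Equiv.swap_apply_of_ne_of_ne (fun h1 => h.1 ?_) (fun h1 => h.2 ?_)
    · rw [hinj (a₁ := i) (a₂ := p) h1]
    · rw [hinj (a₁ := i) (a₂ := q) h1]

theorem mergeMap_toggle {n d : ℕ} {f : Fin n → Fin (d + 1)} {u w : Fin n} {j : Fin d}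
    (hu : mergeMap j (f u) = j) (hw : mergeMap j (f w) = j) :
    mergeMap j ∘ toggle u w f = mergeMap j ∘ f := by
  funext x
  simp only [toggle, Function.comp]
  split_ifs with h
  · rfl
  · rw [Equiv.swap_apply_def]
    split_ifs with h1 h2
    · rw [h1, hu, hw]
    · rw [h2, hu, hw]
    · rfl

theorem IsBig.toggle {n m k : ℕ} (hk : 2 ≤ k) {f : Fin n → Fin m} {u w : Fin n}
    (hb : IsBig k f (f u)) (huw : f w ≠ f u) : IsBig k (toggle u w f) (f w) := by
  have hwu : w ≠ u := by rintro rfl; exact huw rfl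
  have hw : ∀ x, f x = f w → x = w := fun x hx => hb.inj x w hx (by rwa [hx])
  constructor
  · have : (univ.filter fun x => ColoringComplex.toggle u w f x = f w) =
        insert w ((univ.filter fun x => f x = f u).erase u) := by
      ext x
      simp only [mem_filter, mem_univ, true_and, mem_insert, mem_erase]
      simp only [ColoringComplex.toggle]
      by_cases hxu : x = u
      · subst hxu; simp [huw.symm, hwu.symm]
      by_cases hxw : x = w
      · subst hxw; simp
      simp only [hxu, hxw, or_self, if_false, Equiv.swap_apply_eq_iff, Equiv.swap_apply_right]
      simp [hxu]
    rw [this, card_insert_of_notMem (by simp [huw]), card_erase_of_mem (by simp), hb.card]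
    omega
  · have key : ∀ x, ColoringComplex.toggle u w f x ≠ f w →
        ColoringComplex.toggle u w f x = f x ∧ (x = u ∨ f x ≠ f u) := by
      intro x hx
      simp only [ColoringComplex.toggle] at hx ⊢
      split_ifs at hx ⊢ with h
      · rcases h with rfl | rfl
        · simp
        · exact absurd rfl hx
      · push Not at h
        have h1 : f x ≠ f u := fun h1 => hx (by rw [h1, Equiv.swap_apply_left])
        exact ⟨Equiv.swap_apply_of_ne_of_ne h1 fun h2 => h.2 (hw x h2), Or.inr h1⟩
    intro x y hxy hne
    obtain ⟨h1, h2⟩ := key x hne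
    obtain ⟨h3, h4⟩ := key y (hxy ▸ hne)
    have h5 : f x = f y := by rw [← h1, ← h3, hxy]
    by_cases h6 : f x = f u
    · rw [h2.resolve_right (not_not.2 h6), h4.resolve_right (not_not.2 (h5 ▸ h6))]
    · exact hb.inj x y h5 h6

theorem cycle_swapFace {n k d : ℕ} (hn : n = k + d) (hk : 2 ≤ k) {τ : Fin (d + 1) → Fin n} {c : ℕ}
    {f : LamBas n (completeIn n k) (d + 1)} (hf : cycle τ c f ≠ 0) {p q : Fin (d + 1)}
    (hpq : p ≠ q) (hside : (p : ℕ) < c ↔ (q : ℕ) < c) :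
    cycle τ c (swapFace hn f (τ p) (τ q)) = -cycle τ c f := by
  obtain ⟨h, hb⟩ := exists_isBig hn f.2.1 f.2.2
  obtain ⟨hc, hinj⟩ := compat_of_cycle_ne_zero hk hb hf
  have hτ : Function.Injective τ := hinj.of_comp
  have hcomp : (swapFace hn f (τ p) (τ q)).1 ∘ τ = (f.1 ∘ τ) ∘ Equiv.swap p q := by
    funext i
    simp only [swapFace, Function.comp, hτ.swap_apply]
  have hc' : Compat τ c (swapFace hn f (τ p) (τ q)).1 h := by
    intro i
    have h1 : (swapFace hn f (τ p) (τ q)).1 (τ i) = f.1 (τ (Equiv.swap p q i)) := congrFun hcomp i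
    rw [h1]
    have h2 := hc (Equiv.swap p q i)
    have h3 : ((Equiv.swap p q i : Fin (d + 1)) : ℕ) < c ↔ (i : ℕ) < c := by
      rw [Equiv.swap_apply_def]
      split_ifs with h4 h5
      · rw [h4, hside]
      · rw [h5, hside]
      · rfl
    omega
  rw [cycle_eq hk τ c _ (hb.comp_perm _ : IsBig k (swapFace hn f (τ p) (τ q)).1 h),
    cycle_eq hk τ c f hb, if_pos hc, if_pos hc', hcomp, mapSign_comp_swap _ hpq]
  ring

theorem exists_toggle {n k d : ℕ} (hn : n = k + d) (hk : 2 ≤ k) {τ : Fin (d + 1) → Fin n} {c : ℕ}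
    {f : LamBas n (completeIn n k) (d + 1)} (hf : cycle τ c f ≠ 0) {p q : Fin (d + 1)}
    (hpq : (f.1 (τ q) : ℕ) = f.1 (τ p) + 1) (hside : ¬((p : ℕ) < c ↔ (q : ℕ) < c)) :
    ∃ f' : LamBas n (completeIn n k) (d + 1), f'.1 = toggle (τ p) (τ q) f.1 ∧
      cycle τ c f' = -cycle τ c f := by
  obtain ⟨h, hb⟩ := exists_isBig hn f.2.1 f.2.2
  obtain ⟨hc, hinj⟩ := compat_of_cycle_ne_zero hk hb hf
  have hp := hc p
  have hq := hc q
  obtain ⟨h', hb', hcase⟩ : ∃ h' : Fin (d + 1), IsBig k (toggle (τ p) (τ q) f.1) h' ∧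
      ((h = f.1 (τ p) ∧ h' = f.1 (τ q)) ∨ (h = f.1 (τ q) ∧ h' = f.1 (τ p))) := by
    have : h = f.1 (τ p) ∨ h = f.1 (τ q) := by omega
    rcases this with rfl | rfl
    · exact ⟨_, hb.toggle hk (w := τ q) (by omega), Or.inl ⟨rfl, rfl⟩⟩
    · exact ⟨_, toggle_comm (τ q) (τ p) f.1 ▸ hb.toggle hk (w := τ p) (by omega),
        Or.inr ⟨rfl, rfl⟩⟩
  have hcomp := toggle_comp hinj p q
  have hsurj : Function.Surjective (toggle (τ p) (τ q) f.1) := by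
    refine Function.Surjective.of_comp (g := τ) ?_
    rw [hcomp]
    exact Finite.surjective_of_injective hinj
  let f' : LamBas n (completeIn n k) (d + 1) :=
    ⟨toggle (τ p) (τ q) f.1, hsurj, hb'.completeIn⟩
  refine ⟨f', rfl, ?_⟩
  have hc' : Compat τ c f'.1 h' := by
    intro i
    have h1 : toggle (τ p) (τ q) f.1 (τ i) = f.1 (τ i) := congrFun hcomp i
    change (toggle (τ p) (τ q) f.1 (τ i) < h' → _) ∧ (h' < toggle (τ p) (τ q) f.1 (τ i) → _)
    rw [h1]
    have h2 := hc i
    have h3 : f.1 (τ i) = f.1 (τ p) → i = p := fun h => hinj h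
    have h4 : f.1 (τ i) = f.1 (τ q) → i = q := fun h => hinj h
    by_cases h5 : i = p
    · subst h5; omega
    by_cases h6 : i = q
    · subst h6; omega
    have h7 := mt h3 h5
    have h8 := mt h4 h6
    omega
  have hcomp' : f'.1 ∘ τ = f.1 ∘ τ := hcomp
  rw [cycle_eq hk τ c f' hb', cycle_eq hk τ c f hb, if_pos hc, if_pos hc', hcomp']
  rcases hcase with ⟨rfl, rfl⟩ | ⟨rfl, rfl⟩ <;> rw [hpq, pow_succ] <;> ring

theorem sum_cycle_merge {n k d : ℕ} (hn : n = k + d) (hk : 2 ≤ k) (τ : Fin (d + 1) → Fin n) (c : ℕ)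
    (g : LamBas n (completeIn n k) d) (j : Fin d) :
    ∑ f ∈ univ.filter (fun f : LamBas n (completeIn n k) (d + 1) =>
      mergeMap j ∘ f.1 = g.1 ∧ cycle τ c f ≠ 0), cycle τ c f = 0 := by
  set s := univ.filter (fun f : LamBas n (completeIn n k) (d + 1) =>
      mergeMap j ∘ f.1 = g.1 ∧ cycle τ c f ≠ 0) with hs
  rcases s.eq_empty_or_nonempty with hempty | ⟨f₀, hf₀⟩
  · rw [hempty, sum_empty]
  have hmem : ∀ f, f ∈ s ↔ mergeMap j ∘ f.1 = g.1 ∧ cycle τ c f ≠ 0 := by simp [hs]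
  have hinj : ∀ f ∈ s, Function.Injective (f.1 ∘ τ) := by
    intro f hf
    obtain ⟨h, hb⟩ := exists_isBig hn f.2.1 f.2.2
    exact (compat_of_cycle_ne_zero hk hb ((hmem f).1 hf).2).2
  have hsurj := Finite.surjective_of_injective (hinj f₀ hf₀)
  obtain ⟨p, hp⟩ := hsurj j.castSucc
  obtain ⟨q, hq⟩ := hsurj j.succ
  have hpq : p ≠ q := by
    rintro rfl
    rw [hp, Fin.ext_iff] at hq
    simp at hq
  have hgp : g.1 (τ p) = j := by
    rw [← ((hmem f₀).1 hf₀).1]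
    exact (mergeMap_eq_self j _).2 (Or.inl (by rw [show f₀.1 (τ p) = _ from hp]; simp))
  have hgq : g.1 (τ q) = j := by
    rw [← ((hmem f₀).1 hf₀).1]
    exact (mergeMap_eq_self j _).2 (Or.inr (by rw [show f₀.1 (τ q) = _ from hq]; simp))
  have hfp : ∀ f ∈ s, mergeMap j (f.1 (τ p)) = j ∧ mergeMap j (f.1 (τ q)) = j := by
    intro f hf
    have h1 : ∀ x, mergeMap j (f.1 x) = g.1 x := fun x => congrFun ((hmem f).1 hf).1 x
    exact ⟨by rw [h1, hgp], by rw [h1, hgq]⟩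
  let flip : (Fin n → Fin (d + 1)) → (Fin n → Fin (d + 1)) := fun f =>
    if (p : ℕ) < c ↔ (q : ℕ) < c then f ∘ Equiv.swap (τ p) (τ q) else toggle (τ p) (τ q) f
  have hflip : ∀ f, flip (flip f) = f := by
    intro f
    simp only [flip]
    split_ifs
    · funext x; simp
    · exact toggle_toggle _ _ _
  have hex : ∀ f ∈ s, ∃ f' ∈ s, f'.1 = flip f.1 ∧ cycle τ c f' = -cycle τ c f := by
    intro f hf
    obtain ⟨hm, hne⟩ := (hmem f).1 hf
    obtain ⟨h1, h2⟩ := hfp f hf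
    by_cases hside : (p : ℕ) < c ↔ (q : ℕ) < c
    · have h3 := cycle_swapFace hn hk hne hpq hside
      refine ⟨swapFace hn f (τ p) (τ q), (hmem _).2 ⟨?_, by rw [h3]; exact neg_ne_zero.2 hne⟩,
        by simp [flip, hside, swapFace], h3⟩
      rw [← hm]
      funext x
      simp only [swapFace, Function.comp]
      rw [Equiv.swap_apply_def]
      split_ifs with h4 h5
      · rw [h4, h1, h2]
      · rw [h5, h1, h2]
      · rfl
    · obtain ⟨f', hf', hcyc⟩ : ∃ f' : LamBas n (completeIn n k) (d + 1),
          f'.1 = toggle (τ p) (τ q) f.1 ∧ cycle τ c f' = -cycle τ c f := by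
        have hne' : f.1 (τ p) ≠ f.1 (τ q) := fun h => hpq (hinj f hf h)
        have h3 := (mergeMap_eq_self _ _).1 h1
        have h4 := (mergeMap_eq_self _ _).1 h2
        rcases lt_or_gt_of_ne hne' with h5 | h5
        · exact exists_toggle hn hk hne (by omega) hside
        · rw [toggle_comm]
          exact exists_toggle hn hk hne (by omega) (by rwa [iff_comm])
      refine ⟨f', (hmem _).2 ⟨?_, by rw [hcyc]; exact neg_ne_zero.2 hne⟩,
        by simp only [flip, if_neg hside, hf'], hcyc⟩
      rw [← hm, hf', mergeMap_toggle h1 h2]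
  have : Nonempty (LamBas n (completeIn n k) (d + 1)) := ⟨f₀⟩
  choose! G hGs hGflip hGc using hex
  refine sum_involution (fun f _ => G f) (fun f hf => ?_) (fun f hf hne heq => ?_)
    (fun f hf => hGs f hf) (fun f hf => ?_)
  · rw [hGc f hf, add_neg_cancel]
  · have := hGc f hf
    rw [heq] at this
    omega
  · exact Subtype.ext (by rw [hGflip _ (hGs f hf), hGflip f hf, hflip])

theorem sum_coLamBnd_mul_cycle {n k d : ℕ} (hn : n = k + d) (hk : 2 ≤ k)
    (τ : Fin (d + 1) → Fin n) (c : ℕ) (v : LamBas n (completeIn n k) d → ℤ) :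
    ∑ f, coLamBnd n (completeIn n k) d v f * cycle τ c f = 0 := by
  have key : ∀ g, ∑ f, coLamMat n (completeIn n k) d g f * cycle τ c f = 0 := by
    intro g
    simp only [coLamMat, sum_mul]
    rw [sum_comm]
    refine sum_eq_zero fun j _ => ?_
    simp only [mul_assoc]
    rw [← mul_sum]
    have hz := sum_cycle_merge hn hk τ c g j
    rw [sum_filter] at hz
    refine mul_eq_zero_of_right _ (Eq.trans (sum_congr rfl fun f _ => ?_) hz)
    by_cases h1 : mergeMap j ∘ f.1 = g.1 <;> by_cases h2 : cycle τ c f = 0 <;> simp [h1, h2]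
  have : ∀ f, coLamBnd n (completeIn n k) d v f * cycle τ c f =
      ∑ g, v g * (coLamMat n (completeIn n k) d g f * cycle τ c f) := by
    intro f
    simp only [coLamBnd, matLin, LinearMap.coe_mk, AddHom.coe_mk, sum_mul, mul_assoc]
  simp only [this]
  rw [sum_comm]
  refine sum_eq_zero fun g _ => ?_
  rw [← mul_sum, key, mul_zero]

/-- For a surjection `f`, the largest element of each block. -/
theorem exists_max_section {n m : ℕ} {f : Fin n → Fin m} (hf : Function.Surjective f) :
    ∃ τ : Fin m → Fin n, ∀ i, f (τ i) = i ∧ ∀ x, f x = i → x ≤ τ i := by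
  have : ∀ i, ∃ t, f t = i ∧ ∀ x, f x = i → x ≤ t := by
    intro i
    obtain ⟨y, hy⟩ := hf i
    obtain ⟨b, hb, hmax⟩ := exists_max_image (univ.filter fun x => f x = i) id
      ⟨y, by simpa using hy⟩
    simp only [mem_filter, mem_univ, true_and, id] at hb hmax
    exact ⟨b, hb, hmax⟩
  choose τ hτ using this
  exact ⟨τ, hτ⟩

theorem cycle_self_ne_zero {n k d : ℕ} (hk : 2 ≤ k) (f : LamBas n (completeIn n k) (d + 1))
    {h : Fin (d + 1)} (hb : IsBig k f.1 h) {τ : Fin (d + 1) → Fin n} (hτ : ∀ i, f.1 (τ i) = i) :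
    cycle τ h f ≠ 0 := by
  have hc : Compat τ h f.1 h := fun i => by rw [hτ]; omega
  have hid : f.1 ∘ τ = id := funext hτ
  rw [cycle_eq hk τ h f hb, if_pos hc, hid, mapSign_id, mul_one]
  exact pow_ne_zero _ (by norm_num)

/-- The cycle attached to a homology facet `f` vanishes on every other homology facet whose
big block is not further to the left. -/
theorem eq_of_cycle_ne_zero {n k d : ℕ} (hk : 2 ≤ k) {f f' : LamBas n (completeIn n k) (d + 1)}
    {h h' : Fin (d + 1)} (hg : IsGamma k f.1 h) (hg' : IsGamma k f'.1 h')
    {τ : Fin (d + 1) → Fin n} (hτ : ∀ i, f.1 (τ i) = i ∧ ∀ x, f.1 x = i → x ≤ τ i)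
    (hne : cycle τ h f' ≠ 0) (hle : h ≤ h') : f' = f := by
  obtain ⟨hc, hinj⟩ := compat_of_cycle_ne_zero hk hg'.big hne
  have hsurj := Finite.surjective_of_injective hinj
  set π : Fin (d + 1) → Fin (d + 1) := f'.1 ∘ τ with hπ
  have hc' : ∀ i, (π i < h' → i < h) ∧ (h' < π i → h ≤ i) := fun i => hc i
  have hsub : (univ.filter fun i => π i < h').image id ⊆ univ.filter fun i => i < h := by
    intro i hi
    simp only [image_id, mem_filter, mem_univ, true_and] at hi ⊢
    exact (hc' i).1 hi
  have hcard : (univ.filter fun i => π i < h').card = h' := by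
    have : (univ.filter fun i => π i < h').card = (univ.filter fun i => i < h').card := by
      refine card_bij (fun i _ => π i) (by simp) (fun i _ i' _ hii => hinj hii) fun i hi => ?_
      obtain ⟨i', rfl⟩ := hsurj i
      exact ⟨i', by simpa using hi, rfl⟩
    rw [this, filter_gt_eq_Iio, Fin.card_Iio]
  have hcard' : (univ.filter fun i : Fin (d + 1) => i < h).card = h := by
    rw [filter_gt_eq_Iio, Fin.card_Iio]
  rw [image_id] at hsub
  have hhh : h' = h := by
    have := card_le_card hsub
    apply Fin.ext
    omega
  subst hhh
  have heq := eq_of_subset_of_card_le hsub (by rw [hcard, hcard'])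
  have hlt : ∀ i, π i < h' ↔ i < h' := by
    intro i
    simpa using congrArg (i ∈ ·) heq
  have hτlt : ∀ i i', i < i' → (i' < h' ∨ h' ≤ i) → τ i' < τ i := by
    intro i i' hii hs
    by_cases hi : i = h'
    · subst hi
      obtain ⟨x, hx, hlt⟩ := hg.exists_lt f.2.1 (y := τ i') (by rw [(hτ i').1]; exact hii)
      exact hlt.trans_le ((hτ i).2 x hx)
    · exact hg.lt f.2.1 (by rw [(hτ i).1, (hτ i').1]; exact hii)
        (by rw [(hτ i).1, (hτ i').1]; omega)
  have hπh : π h' = h' := by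
    by_contra hneh
    have h1 : h' < π h' := by
      have := (hlt h').not.2 (lt_irrefl h')
      omega
    obtain ⟨x, hx, hxlt⟩ := hg'.exists_lt f'.2.1 (y := τ h') h1
    have h2 : ∀ i, τ i = x → False := by
      rintro i rfl
      have h3 : ¬ i < h' := by
        rw [← hlt]
        exact fun h => absurd hx h.ne
      rcases eq_or_ne i h' with rfl | h4
      · exact lt_irrefl _ hxlt
      · exact lt_asymm hxlt (hτlt h' i (by omega) (Or.inr le_rfl))
    have hfx : f.1 x = h' := by
      by_contra h3
      exact h2 (f.1 x) (hg.big.inj _ _ (hτ _).1 (by rwa [(hτ _).1]))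
    exact absurd ((hτ h').2 x hfx) (not_le.2 hxlt)
  have hmono : StrictMono π := by
    intro i i' hii
    have hlti := hlt i
    have hlti' := hlt i'
    have hne' : π i ≠ π i' := fun h => hii.ne (hinj h)
    by_contra hcon
    have hgt : π i' < π i := by omega
    by_cases hs : π i < h' ∨ h' < π i'
    · have h1 : τ i < τ i' := hg'.lt f'.2.1 hgt hs
      have h2 : τ i' < τ i := hτlt i i' hii (by omega)
      exact lt_asymm h1 h2
    · have h3 : π i' = h' := by omega
      have h4 : i' = h' := hinj (h3.trans hπh.symm)
      omega
  have hid := hmono.range_inj strictMono_id |>.1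
    (Set.range_id.symm ▸ hsurj.range_eq)
  have hf'τ : ∀ i, f'.1 (τ i) = i := fun i => congrFun hid i
  refine Subtype.ext (funext fun x => ?_)
  by_cases hx : f.1 x = h'
  · by_contra hne'
    have h1 : x = τ (f'.1 x) := hg'.big.inj _ _ (hf'τ _).symm (by rwa [hx] at hne')
    have h2 := (hτ (f'.1 x)).1
    rw [← h1] at h2
    exact hne' h2.symm
  · have h1 : x = τ (f.1 x) := hg.big.inj _ _ (hτ _).1.symm hx
    conv_lhs => rw [h1]
    exact hf'τ _

theorem isEmpty_face {n k d : ℕ} (hn : n = k + d) :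
    IsEmpty (LamBas n (completeIn n k) (d + 2)) := by
  refine ⟨fun f => ?_⟩
  obtain ⟨e, he, i, hi⟩ := f.2.2
  have h1 : (e.image f.1).card ≤ 1 :=
    card_le_one.2 fun a ha b hb => by
      obtain ⟨x, hx, rfl⟩ := mem_image.1 ha
      obtain ⟨y, hy, rfl⟩ := mem_image.1 hb
      rw [hi x hx, hi y hy]
  have h2 : (univ : Finset (Fin (d + 2))) ⊆ e.image f.1 ∪ (univ \ e).image f.1 := by
    intro y _
    obtain ⟨x, rfl⟩ := f.2.1 y
    by_cases hx : x ∈ e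
    · exact mem_union_left _ (mem_image_of_mem _ hx)
    · exact mem_union_right _ (mem_image_of_mem _ (by simp [hx]))
  have h3 := (card_le_card h2).trans (card_union_le _ _)
  have h4 : ((univ \ e).image f.1).card ≤ d := by
    refine card_image_le.trans ?_
    rw [card_sdiff_of_subset (subset_univ e), he, card_univ, Fintype.card_fin]
    omega
  rw [card_univ, Fintype.card_fin] at h3
  omega

/-- A combination of homology facets which is a coboundary is trivial. -/
theorem coeff_eq_zero {n k d : ℕ} (hn : n = k + d) (hk : 2 ≤ k)
    (w : LamBas n (completeIn n k) (d + 1) → ℤ) (hw : ∀ f, w f ≠ 0 → ∃ h, IsGamma k f.1 h)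
    (hrange : w ∈ LinearMap.range (coLamBnd n (completeIn n k) d)) : w = 0 := by
  obtain ⟨v, rfl⟩ := hrange
  set w := coLamBnd n (completeIn n k) d v with hwdef
  have key : ∀ t : ℕ, ∀ f h, IsGamma k f.1 h → (h : ℕ) = t → w f = 0 := by
    intro t
    induction t using Nat.strong_induction_on with
    | _ t ih =>
      intro f h hg ht
      obtain ⟨τ, hτ⟩ := exists_max_section f.2.1
      have h1 := sum_coLamBnd_mul_cycle hn hk τ h v
      rw [sum_eq_single f] at h1
      · exact (mul_eq_zero.1 h1).resolve_right
          (cycle_self_ne_zero hk f hg.big fun i => (hτ i).1)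
      · intro f' _ hne
        by_contra h2
        obtain ⟨h', hg'⟩ := hw f' (left_ne_zero_of_mul h2)
        rcases lt_or_ge h' h with hlt | hge
        · exact left_ne_zero_of_mul h2 (ih h' (by omega) f' h' hg' rfl)
        · exact hne (eq_of_cycle_ne_zero hk hg hg' hτ (right_ne_zero_of_mul h2) hge)
      · simp
  funext f
  by_contra h1
  obtain ⟨h, hg⟩ := hw f h1
  exact h1 (key h f h hg rfl)

end ColoringComplex

/-- Theorem (paper Cor. `Cohomology_Basis`): for the complete `k`-uniform hypergraph `H` on
`n` vertices (`k ≥ 3`, `k > n/2`, `k ≤ n-1`), the cochains `σ^F` for `F ∈ Γ` are cocycles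
and their classes form a basis of the reduced cohomology `H̃^{n-k-1}(Λ(H); ℤ)`.  Cohomological
degree `n-k-1` corresponds to partitions with `n-k+1` blocks, and `σ^F = Pi.single F 1`. -/
theorem cohomology_basis_complete (n k : ℕ) (hk : 3 ≤ k) (hhalf : n < 2 * k)
    (hkn : k ≤ n - 1) :
    ∃ hker : ∀ F : {f : LamBas n (completeIn n k) (n - k + 1) // gammaCond n k f.1},
        coLamBnd n (completeIn n k) (n - k + 1) (Pi.single F.1 (1 : ℤ)) = 0,
      let fam : {f : LamBas n (completeIn n k) (n - k + 1) // gammaCond n k f.1} →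
          homologyOf (coLamBnd n (completeIn n k) (n - k))
            (coLamBnd n (completeIn n k) (n - k + 1)) :=
        fun F => Submodule.Quotient.mk ⟨Pi.single F.1 (1 : ℤ), LinearMap.mem_ker.mpr (hker F)⟩
      LinearIndependent ℤ fam ∧ Submodule.span ℤ (Set.range fam) = ⊤ := by
  classical
  have hn : n = k + (n - k) := by omega
  have hk2 : 2 ≤ k := by omega
  have hE : IsEmpty (LamBas n (completeIn n k) (n - k + 1 + 1)) :=
    ColoringComplex.isEmpty_face hn
  have hker' : ∀ v, coLamBnd n (completeIn n k) (n - k + 1) v = 0 :=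
    fun v => funext fun g => hE.elim g
  have hΓ : ∀ f : LamBas n (completeIn n k) (n - k + 1),
      gammaCond n k f.1 ↔ ∃ h, ColoringComplex.IsGamma k f.1 h := fun f =>
    ColoringComplex.gammaCond_iff hk2 (ColoringComplex.exists_isBig hn f.2.1 f.2.2)
  refine ⟨fun F => hker' _, ?_⟩
  intro fam
  let L : (LamBas n (completeIn n k) (n - k + 1) → ℤ) →ₗ[ℤ]
      homologyOf (coLamBnd n (completeIn n k) (n - k))
        (coLamBnd n (completeIn n k) (n - k + 1)) :=
    (Submodule.mkQ _).comp
      (LinearMap.codRestrict _ LinearMap.id fun v => LinearMap.mem_ker.mpr (hker' v))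
  have hfam : ∀ F, L (Pi.single F.1 1) = fam F := fun F => rfl
  have hL0 : ∀ v, L v = 0 ↔ v ∈ LinearMap.range (coLamBnd n (completeIn n k) (n - k)) := by
    intro v
    exact Submodule.Quotient.mk_eq_zero _
  have hLsurj : ∀ q, ∃ v, L v = q := by
    intro q
    obtain ⟨v, rfl⟩ := Submodule.Quotient.mk_surjective _ q
    exact ⟨v.1, rfl⟩
  constructor
  · have : Fintype {f : LamBas n (completeIn n k) (n - k + 1) // gammaCond n k f.1} :=
      Fintype.ofFinite _
    rw [Fintype.linearIndependent_iff]
    intro c hc F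
    set w : LamBas n (completeIn n k) (n - k + 1) → ℤ :=
      ∑ F, c F • Pi.single F.1 (1 : ℤ) with hw
    have hwF : ∀ f, w f = ∑ F, if f = F.1 then c F else 0 := by
      intro f
      simp [hw, Finset.sum_apply, Pi.single_apply]
    have hw0 : w = 0 := by
      refine ColoringComplex.coeff_eq_zero hn hk2 w (fun f hf => ?_) ?_
      · rw [hwF] at hf
        obtain ⟨F, -, hF⟩ := Finset.exists_ne_zero_of_sum_ne_zero hf
        obtain rfl : f = F.1 := by
          by_contra h
          exact hF (if_neg h)
        exact (hΓ _).1 F.2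
      · rw [← hL0, hw, map_sum]
        simpa only [map_smul, hfam] using hc
    have h1 := hwF F.1
    rw [hw0, Finset.sum_eq_single F] at h1
    · simpa using h1.symm
    · intro F' _ hne
      exact if_neg fun h => hne (Subtype.ext h.symm)
    · simp
  · rw [eq_top_iff]
    intro q _
    obtain ⟨v, rfl⟩ := hLsurj q
    have hsingle : ∀ f, L (Pi.single f 1) ∈ Submodule.span ℤ (Set.range fam) := by
      intro f
      refine ColoringComplex.single_mem hn hk2 hhalf
        (N := (Submodule.span ℤ (Set.range fam)).comap L) ?_ ?_ f
      · intro u hu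
        rw [Submodule.mem_comap, (hL0 u).2 hu]
        exact Submodule.zero_mem _
      · intro f h hf
        exact Submodule.subset_span ⟨⟨f, (hΓ f).2 ⟨h, hf⟩⟩, rfl⟩
    have hv : v = ∑ f, v f • Pi.single f (1 : ℤ) := by
      funext g
      simp [Finset.sum_apply, Pi.single_apply]
    rw [hv, map_sum]
    refine Submodule.sum_mem _ fun f _ => ?_
    rw [map_smul]
    exact Submodule.smul_mem _ _ (hsingle f)
end
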